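/- arXiv:2406.17372 — 6 statements merged into one kernel-verified Lean document; each statement's English description precedes it below -/
import Mathlib

section
/- There exist real constants δ₀ > 0 and C₀ ≥ 1 such that for every positive integer k and every group G that is generated by some set of at most k elements, there exists a finite nonempty multiset A of elements of G with |A| ≤ C₀·k such that A has detection probability at least δ₀ in G. -/
open scoped Classical

/-- `A` has detection probability at least `δ` in `G`: for every proper subgroup `H` of `G`,
the number of elements of `A` (with multiplicity) lying in `H` is at most `(1 - δ) * |A|`. -/
def Detects {G : Type*} [Group G] (A : Multiset G) (δ : ℝ) : Prop :=
  ∀ H : Subgroup G, H ≠ ⊤ →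
    ((A.filter (fun a => a ∈ H)).card : ℝ) ≤ (1 - δ) * (Multiset.card A : ℝ)

theorem aux_choose (n t : ℕ) : (n.choose t : ℝ) * (t : ℝ) ^ t ≤ (3 * (n : ℝ)) ^ t := by
  have h1 : (n.choose t : ℝ) ≤ (n : ℝ) ^ t / (t.factorial : ℝ) := Nat.choose_le_pow_div t n
  have h2 : (t : ℝ) ^ t / (t.factorial : ℝ) ≤ Real.exp t :=
    Real.pow_div_factorial_le_exp (t : ℝ) (Nat.cast_nonneg t) t
  have h3 : Real.exp (t : ℝ) ≤ 3 ^ t := by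
    rw [← Real.exp_one_pow t]
    exact pow_le_pow_left₀ (Real.exp_pos 1).le (by linarith [Real.exp_one_lt_d9]) t
  calc (n.choose t : ℝ) * (t : ℝ) ^ t ≤ ((n : ℝ) ^ t / (t.factorial : ℝ)) * (t : ℝ) ^ t := by gcongr
    _ = (n : ℝ) ^ t * ((t : ℝ) ^ t / (t.factorial : ℝ)) := by ring
    _ ≤ (n : ℝ) ^ t * 3 ^ t := by gcongr; exact h2.trans h3
    _ = (3 * (n : ℝ)) ^ t := by rw [mul_pow]; ring

theorem aux_term (M s : ℕ) (hs : 10 ^ 6 * s ≤ M) :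
    (((2 * M).choose s : ℕ) : ℝ) * (M.choose (6 * s) : ℝ) * ((6 * s : ℕ) : ℝ) ^ (8 * s)
      ≤ (1 / 4) ^ s * (M : ℝ) ^ (8 * s) := by
  have h1 := aux_choose (2 * M) s
  have h2 := aux_choose M (6 * s)
  have hs' : (10 : ℝ) ^ 6 * s ≤ M := by exact_mod_cast hs
  have h3 : (36 * (s : ℝ)) ^ s ≤ (36 / 10 ^ 6 * (M : ℝ)) ^ s := by
    gcongr ?_ ^ s
    linarith
  calc (((2 * M).choose s : ℕ) : ℝ) * (M.choose (6 * s) : ℝ) * ((6 * s : ℕ) : ℝ) ^ (8 * s)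
      = ((((2 * M).choose s : ℕ) : ℝ) * (s : ℝ) ^ s) *
        ((M.choose (6 * s) : ℝ) * ((6 * s : ℕ) : ℝ) ^ (6 * s)) * (36 * (s : ℝ)) ^ s := by
        have : ((6 * s : ℕ) : ℝ) ^ (8 * s)
            = ((6 * s : ℕ) : ℝ) ^ (6 * s) * ((s : ℝ) ^ s * (36 * (s : ℝ)) ^ s) := by
          rw [show 8 * s = 6 * s + 2 * s by ring, pow_add, pow_mul _ 2 s, ← mul_pow]
          congr 2
          push_cast
          ring
        rw [this]; ring
    _ ≤ ((3 * ((2 * M : ℕ) : ℝ)) ^ s) * ((3 * (M : ℝ)) ^ (6 * s))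
        * (36 / 10 ^ 6 * (M : ℝ)) ^ s := by gcongr
    _ = ((6 * 729 * 36 / 10 ^ 6) * (M : ℝ) ^ 8) ^ s := by
        rw [pow_mul _ 6 s, ← mul_pow, ← mul_pow]
        congr 1
        push_cast
        ring
    _ ≤ ((1 / 4) * (M : ℝ) ^ 8) ^ s := by
        have : (6 * 729 * 36 / 10 ^ 6 : ℝ) ≤ 1 / 4 := by norm_num
        exact pow_le_pow_left₀ (by positivity) (mul_le_mul_of_nonneg_right this (by positivity)) s
    _ = (1 / 4) ^ s * (M : ℝ) ^ (8 * s) := by rw [mul_pow, ← pow_mul]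

theorem aux_count (M : ℕ) (S : Finset (Fin (2 * M))) (T : Finset (Fin M)) :
    (Fintype.piFinset (fun p : Fin (2 * M) × Fin 8 => if p.1 ∈ S then T else Finset.univ)).card
      = T.card ^ (8 * S.card) * M ^ (8 * (2 * M - S.card)) := by
  rw [Fintype.card_piFinset, Fintype.prod_prod_type]
  have : ∀ i : Fin (2 * M), ∏ _j : Fin 8, (if i ∈ S then T else Finset.univ).card
      = if i ∈ S then T.card ^ 8 else M ^ 8 := by
    intro i; split_ifs <;> simp
  refine (Finset.prod_congr rfl fun i _ => this i).trans ?_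
  rw [Finset.prod_ite]
  simp only [Finset.prod_const, ← pow_mul]
  congr 3
  · simp
  · rw [← Finset.compl_filter, Finset.card_compl]
    simp

theorem aux_expander (M : ℕ) (hM : 0 < M) : ∃ f : Fin (2 * M) × Fin 8 → Fin M,
    ∀ S : Finset (Fin (2 * M)), 10 ^ 6 * S.card ≤ M →
      6 * S.card ≤ ((S ×ˢ (Finset.univ : Finset (Fin 8))).image f).card := by
  by_contra hcon
  push Not at hcon
  let B : Finset (Fin (2 * M)) → Finset (Fin M) → Finset (Fin (2 * M) × Fin 8 → Fin M) :=
    fun S T => Fintype.piFinset (fun p => if p.1 ∈ S then T else Finset.univ)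
  let K := M / 10 ^ 6
  have hcov : (Finset.univ : Finset (Fin (2 * M) × Fin 8 → Fin M)) ⊆
      (Finset.Icc 1 K).biUnion fun s =>
        (Finset.powersetCard s (Finset.univ : Finset (Fin (2 * M)))).biUnion fun S =>
          (Finset.powersetCard (6 * s) (Finset.univ : Finset (Fin M))).biUnion fun T => B S T := by
    intro f _
    obtain ⟨S, hS, hlt⟩ := hcon f
    have hle : 6 * S.card ≤ Fintype.card (Fin M) := by simp; omega
    obtain ⟨T, hT, hTc⟩ := Finset.exists_superset_card_eq hlt.le hle
    simp only [Finset.mem_biUnion, Finset.mem_powersetCard, Finset.mem_Icc]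
    refine ⟨S.card, ⟨by omega, ?_⟩, S, ⟨Finset.subset_univ _, rfl⟩, T,
      ⟨Finset.subset_univ _, hTc⟩, ?_⟩
    · exact (Nat.le_div_iff_mul_le (by norm_num)).2 (by omega)
    · simp only [B, Fintype.mem_piFinset]
      intro p
      split_ifs with hp
      · apply hT
        apply Finset.mem_image_of_mem
        simp [hp]
      · simp
  have hcard := Finset.card_le_card hcov
  have hb : ((Finset.Icc 1 K).biUnion fun s =>
        (Finset.powersetCard s (Finset.univ : Finset (Fin (2 * M)))).biUnion fun S =>
          (Finset.powersetCard (6 * s) (Finset.univ : Finset (Fin M))).biUnion fun T => B S T).card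
      ≤ ∑ s ∈ Finset.Icc 1 K, (2 * M).choose s * (M.choose (6 * s) *
          ((6 * s) ^ (8 * s) * M ^ (8 * (2 * M - s)))) := by
    refine Finset.card_biUnion_le.trans (Finset.sum_le_sum fun s _ => ?_)
    refine (Finset.card_biUnion_le_card_mul _ _
      (M.choose (6 * s) * ((6 * s) ^ (8 * s) * M ^ (8 * (2 * M - s)))) ?_).trans (le_of_eq ?_)
    · intro S hS
      rw [Finset.mem_powersetCard] at hS
      refine (Finset.card_biUnion_le_card_mul _ _
        ((6 * s) ^ (8 * s) * M ^ (8 * (2 * M - s))) ?_).trans (le_of_eq ?_)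
      · intro T hT
        rw [Finset.mem_powersetCard] at hT
        simp only [B]
        rw [aux_count, hS.2, hT.2]
      · simp
    · simp
  have hfin := hcard.trans hb
  have huniv : (Finset.univ : Finset (Fin (2 * M) × Fin 8 → Fin M)).card = M ^ (16 * M) := by
    simp only [Finset.card_univ, Fintype.card_fun, Fintype.card_prod, Fintype.card_fin]
    congr 1; ring
  rw [huniv] at hfin
  have hfinR : (M : ℝ) ^ (16 * M) ≤ ∑ s ∈ Finset.Icc 1 K, (1 / 4 : ℝ) ^ s * (M : ℝ) ^ (16 * M) := by
    calc (M : ℝ) ^ (16 * M) ≤ ((∑ s ∈ Finset.Icc 1 K, (2 * M).choose s * (M.choose (6 * s) *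
          ((6 * s) ^ (8 * s) * M ^ (8 * (2 * M - s)))) : ℕ) : ℝ) := by exact_mod_cast hfin
      _ = ∑ s ∈ Finset.Icc 1 K, (((2 * M).choose s : ℕ) : ℝ) * (M.choose (6 * s) : ℝ) *
          ((6 * s : ℕ) : ℝ) ^ (8 * s) * (M : ℝ) ^ (8 * (2 * M - s)) := by
        push_cast
        exact Finset.sum_congr rfl fun s _ => by ring
      _ ≤ _ := by
        refine Finset.sum_le_sum fun s hs => ?_
        rw [Finset.mem_Icc] at hs
        have hsM : 10 ^ 6 * s ≤ M := by
          have := (Nat.le_div_iff_mul_le (by norm_num : 0 < 10 ^ 6)).1 hs.2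
          omega
        have := aux_term M s hsM
        calc _ ≤ ((1 / 4) ^ s * (M : ℝ) ^ (8 * s)) * (M : ℝ) ^ (8 * (2 * M - s)) := by gcongr
          _ = _ := by
            rw [mul_assoc, ← pow_add]
            congr 2
            omega
  rw [← Finset.sum_mul] at hfinR
  have hpos : (0 : ℝ) < (M : ℝ) ^ (16 * M) := by positivity
  have hsum : ∀ K : ℕ, ∑ s ∈ Finset.Icc 1 K, (1 / 4 : ℝ) ^ s ≤ 1 / 2 - (1 / 4) ^ K / 3 := by
    intro K
    induction K with
    | zero => norm_num
    | succ k ih =>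
      rw [Finset.sum_Icc_succ_top (by omega), pow_succ]
      have : (0 : ℝ) < (1 / 4) ^ k := by positivity
      linarith
  have h4 : (0 : ℝ) < (1 / 4) ^ K := by positivity
  nlinarith [hsum K]

theorem aux_list {G ι : Type*} [Group G] (H : Subgroup G) (g : ι → G) (i : ι) :
    ∀ l : List ι, l.Nodup → i ∈ l → (∀ j ∈ l, j ≠ i → g j ∈ H) → (l.map g).prod ∈ H → g i ∈ H := by
  intro l
  induction l with
  | nil => intro _ h; simp at h
  | cons a l ih =>
    intro hnd hi hall hp
    rw [List.nodup_cons] at hnd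
    rw [List.map_cons, List.prod_cons] at hp
    by_cases hai : a = i
    · subst hai
      refine (Subgroup.mul_mem_cancel_right H ?_).1 hp
      apply Subgroup.list_prod_mem
      intro y hy
      obtain ⟨j, hj, rfl⟩ := List.mem_map.1 hy
      exact hall j (List.mem_cons_of_mem _ hj) (fun h => hnd.1 (h ▸ hj))
    · have ha : g a ∈ H := hall a (by simp) hai
      refine ih hnd.2 ?_ (fun j hj => hall j (List.mem_cons_of_mem _ hj))
        ((Subgroup.mul_mem_cancel_left H ha).1 hp)
      rcases List.mem_cons.1 hi with h | h
      · exact absurd h.symm hai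
      · exact h

/-- Checks: a code with `M` check words for `2M` inputs. -/
theorem aux_check (M : ℕ) (hM : 0 < M) {G : Type*} [Group G] (x : Fin (2 * M) → G) :
    ∃ c : Fin M → G, ∀ H : Subgroup G,
      10 ^ 6 * (Finset.univ.filter fun i => x i ∉ H).card ≤ M →
      4 * (Finset.univ.filter fun i => x i ∉ H).card ≤
        (Finset.univ.filter fun v => c v ∉ H).card := by
  obtain ⟨f, hf⟩ := aux_expander M hM
  refine ⟨fun v => ((List.finRange (2 * M)).map
    fun i => if ∃ d, f (i, d) = v then x i else 1).prod, fun H hH => ?_⟩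
  set S := Finset.univ.filter fun i => x i ∉ H with hS
  set E := Finset.univ.filter fun v => ((List.finRange (2 * M)).map
    fun i => if ∃ d, f (i, d) = v then x i else 1).prod ∉ H with hE
  have h6 := hf S hH
  set P := S ×ˢ (Finset.univ : Finset (Fin 8)) with hP
  have hPc : P.card = 8 * S.card := by simp [hP, mul_comm]
  -- vertices outside E have at least two preimages
  have key : ∀ v ∈ P.image f \ E, 2 ≤ (P.filter fun p => f p = v).card := by
    intro v hv
    rw [Finset.mem_sdiff, Finset.mem_image] at hv
    obtain ⟨⟨⟨i, d⟩, hp, hpv⟩, hvE⟩ := hv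
    by_contra hlt
    push Not at hlt
    have hle : (P.filter fun p => f p = v).card ≤ 1 := by omega
    rw [Finset.card_le_one] at hle
    have hiS : i ∈ S := by simpa [hP] using hp
    have hvH : ((List.finRange (2 * M)).map
      fun i => if ∃ d, f (i, d) = v then x i else 1).prod ∈ H := by
      by_contra h
      exact hvE (by simp only [hE, Finset.mem_filter, Finset.mem_univ, true_and]; exact h)
    have := aux_list H (fun i => if ∃ d, f (i, d) = v then x i else 1) i _
      (List.nodup_finRange _) (List.mem_finRange i) ?_ hvH
    · rw [if_pos ⟨d, hpv⟩] at this
      simp only [hS, Finset.mem_filter] at hiS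
      exact hiS.2 this
    · intro j _ hji
      split_ifs with hj
      · obtain ⟨d', hd'⟩ := hj
        by_contra hxj
        have hjS : j ∈ S := by simp [hS, hxj]
        have := hle (j, d') (by simp [hP, hjS, hd']) (i, d) (by simp [hP, hiS, hpv])
        exact hji (congrArg Prod.fst this)
      · exact H.one_mem
  have hsum : P.card = ∑ v ∈ P.image f, (P.filter fun p => f p = v).card :=
    Finset.card_eq_sum_card_image f P
  have hge1 : ∀ v ∈ P.image f, 1 ≤ (P.filter fun p => f p = v).card := by
    intro v hv
    obtain ⟨p, hp, hpv⟩ := Finset.mem_image.1 hv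
    exact Finset.card_pos.2 ⟨p, by simp [hp, hpv]⟩
  have hlow : ∑ v ∈ P.image f, (2 - if v ∈ E then 1 else 0) ≤
      ∑ v ∈ P.image f, (P.filter fun p => f p = v).card := by
    refine Finset.sum_le_sum fun v hv => ?_
    split_ifs with h
    · exact hge1 v hv
    · exact key v (Finset.mem_sdiff.2 ⟨hv, h⟩)
  have h2 : 2 * (P.image f).card ≤ ∑ v ∈ P.image f, (2 - if v ∈ E then 1 else 0) + E.card := by
    have e1 : ((P.image f).filter (fun v => v ∈ E)).card ≤ E.card :=
      Finset.card_le_card (fun v hv => (Finset.mem_filter.1 hv).2)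
    rw [Finset.card_filter] at e1
    refine le_trans ?_ (Nat.add_le_add_left e1 _)
    rw [← Finset.sum_add_distrib, mul_comm, ← smul_eq_mul]
    refine Finset.card_nsmul_le_sum _ _ _ fun v _ => ?_
    split_ifs <;> simp
  omega

theorem aux_code {G : Type*} [Group G] (n : ℕ) : ∀ x : Fin (2 ^ n) → G,
    ∃ A : Fin (4 * 2 ^ n) → G, ∀ H : Subgroup G,
      2 * 10 ^ 6 * (Finset.univ.filter fun j => A j ∉ H).card ≤ 2 ^ n → ∀ i, x i ∈ H := by
  induction n with
  | zero =>
    intro x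
    refine ⟨fun _ => x 0, fun H hH i => ?_⟩
    by_contra hi
    have : i = 0 := Subsingleton.elim (α := Fin 1) _ _
    subst this
    simp [hi] at hH
  | succ n ih =>
    have hM : 0 < 2 ^ n := by positivity
    have h2 : 2 ^ (n + 1) = 2 * 2 ^ n := by rw [pow_succ, mul_comm]
    rw [h2]
    generalize 2 ^ n = M at *
    intro x
    obtain ⟨y, hy⟩ := aux_check M hM x
    obtain ⟨z, hz⟩ := ih y
    have h4 : 4 * M = 2 * (2 * M) := by ring
    obtain ⟨w, hw⟩ := aux_check (2 * M) (by omega) (fun j => z (Fin.cast h4.symm j))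
    let e : Fin (4 * (2 * M)) ≃ (Fin (2 * M) ⊕ Fin (4 * M)) ⊕ Fin (2 * M) :=
      (Fintype.equivFinOfCardEq (by simp; ring)).symm
    let F : (Fin (2 * M) ⊕ Fin (4 * M)) ⊕ Fin (2 * M) → G := Sum.elim (Sum.elim x z) w
    refine ⟨F ∘ e, fun H hH => ?_⟩
    have hcard : (Finset.univ.filter fun j => (F ∘ e) j ∉ H).card =
        (Finset.univ.filter fun j => x j ∉ H).card + (Finset.univ.filter fun j => z j ∉ H).card
          + (Finset.univ.filter fun j => w j ∉ H).card := by
      simp only [Finset.card_filter, Function.comp]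
      rw [Equiv.sum_comp e (fun j => if F j ∉ H then 1 else 0)]
      simp only [Fintype.sum_sum_type, F, Sum.elim_inl, Sum.elim_inr]
      congr!
    have hzc : (Finset.univ.filter fun j => z (Fin.cast h4.symm j) ∉ H).card =
        (Finset.univ.filter fun j => z j ∉ H).card := by
      simp only [Finset.card_filter]
      exact Equiv.sum_comp (finCongr h4.symm) (fun j => if z j ∉ H then 1 else 0)
    rw [hcard] at hH
    have hw' := hw H
    rw [hzc] at hw'
    have hw'' := hw' (by omega)
    have hyH := hz H (by omega)
    have hx := hy H (by omega)
    have h0 : (Finset.univ.filter fun v => y v ∉ H).card = 0 := by simp [hyH]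
    have hx0 : (Finset.univ.filter fun j => x j ∉ H).card = 0 := by omega
    rw [Finset.card_eq_zero, Finset.filter_eq_empty_iff] at hx0
    intro i
    simpa using hx0 (Finset.mem_univ i)

theorem stmt0 :
    ∃ δ₀ : ℝ, 0 < δ₀ ∧ ∃ C₀ : ℝ, 1 ≤ C₀ ∧
      ∀ k : ℕ, 0 < k → ∀ (G : Type*) [Group G],
        (∃ S : Finset G, S.card ≤ k ∧ Subgroup.closure (S : Set G) = ⊤) →
        ∃ A : Multiset G, A ≠ 0 ∧ (Multiset.card A : ℝ) ≤ C₀ * k ∧ Detects A δ₀ := by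
  refine ⟨1 / (8 * 10 ^ 6), by norm_num, 8, by norm_num, ?_⟩
  intro k hk G _ ⟨S, hSk, hS⟩
  obtain ⟨n, hn1, hn2⟩ : ∃ n : ℕ, k ≤ 2 ^ n ∧ 2 ^ n ≤ 2 * k := by
    refine ⟨Nat.log 2 k + 1, (Nat.lt_pow_succ_log_self (by norm_num) k).le, ?_⟩
    rw [pow_succ, mul_comm]
    exact Nat.mul_le_mul_left 2 (Nat.pow_log_le_self 2 hk.ne')
  let x : Fin (2 ^ n) → G := fun i =>
    if h : i.1 < S.card then (S.equivFin.symm ⟨i.1, h⟩ : G) else 1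
  have hxS : ∀ g ∈ S, ∃ i, x i = g := by
    intro g hg
    let j := S.equivFin ⟨g, hg⟩
    refine ⟨⟨j.1, lt_of_lt_of_le j.2 (hSk.trans hn1)⟩, ?_⟩
    simp only [x, j.2, dif_pos]
    simp [j]
  obtain ⟨A, hA⟩ := aux_code n x
  have hcA : Multiset.card (Multiset.map A Finset.univ.val) = 4 * 2 ^ n := by simp
  refine ⟨Multiset.map A Finset.univ.val, ?_, ?_, ?_⟩
  · rw [← Multiset.card_pos, hcA]; positivity
  · rw [hcA]
    have : 4 * 2 ^ n ≤ 8 * k := by omega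
    exact_mod_cast this
  · intro H hH
    rw [hcA]
    have hbad : ¬ (2 * 10 ^ 6 * (Finset.univ.filter fun j => A j ∉ H).card ≤ 2 ^ n) := by
      intro h
      apply hH
      rw [eq_top_iff, ← hS, Subgroup.closure_le]
      intro g hg
      obtain ⟨i, rfl⟩ := hxS g hg
      exact hA H h i
    have hfil : ((Multiset.map A Finset.univ.val).filter (fun a => a ∈ H)).card
        = (Finset.univ.filter fun j => A j ∈ H).card := by
      rw [Multiset.filter_map, Multiset.card_map]
      rfl
    have htot := Finset.card_filter_add_card_filter_not
      (s := (Finset.univ : Finset (Fin (4 * 2 ^ n)))) (fun j => A j ∈ H)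
    rw [Finset.card_univ, Fintype.card_fin] at htot
    rw [hfil]
    push Not at hbad
    have htot' : ((Finset.univ.filter fun j => A j ∈ H).card : ℝ)
        + ((Finset.univ.filter fun j => A j ∉ H).card : ℝ) = 4 * 2 ^ n := by exact_mod_cast htot
    have hbad' : (2 : ℝ) ^ n < 2 * 10 ^ 6 * ((Finset.univ.filter fun j => A j ∉ H).card : ℝ) := by
      exact_mod_cast hbad
    push_cast
    linarith
end

section
/- For every integer k ≥ 2, the free group F_k on k generators has a finite nonempty multiset A with |A| ≤ 61·k^13 such that A has detection probability at least 1/8 in F_k. -/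
open scoped Classical

/-- All subproducts of a list. -/
def subProds {G : Type*} [Group G] : List G → Multiset G
  | [] => {1}
  | g :: L => subProds L + (subProds L).map (fun x => g * x)

theorem card_subProds {G : Type*} [Group G] (L : List G) :
    Multiset.card (subProds L) = 2 ^ L.length := by
  induction L with
  | nil => simp [subProds]
  | cons g L ih => simp [subProds, ih, pow_succ]; ring

theorem subProds_half {G : Type*} [Group G] (H : Subgroup G) (L : List G)
    (h : ∃ g ∈ L, g ∉ H) :
    2 * (subProds L).countP (fun a => a ∈ H) ≤ Multiset.card (subProds L) := by
  induction L with
  | nil => simp at h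
  | cons g L ih =>
    simp only [subProds, Multiset.countP_add, Multiset.card_add, Multiset.card_map,
      Multiset.countP_map, ← Multiset.countP_eq_card_filter]
    by_cases hg : g ∈ H
    · have h1 : ∃ g ∈ L, g ∉ H := by
        obtain ⟨x, hx, hxH⟩ := h
        rcases List.mem_cons.1 hx with rfl | hx
        · exact absurd hg hxH
        · exact ⟨x, hx, hxH⟩
      have := ih h1
      have e : (subProds L).countP (fun a => g * a ∈ H)
          = (subProds L).countP (fun a => a ∈ H) := by
        apply Multiset.countP_congr rfl
        intro x _
        simp [H.mul_mem_cancel_left hg]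
      omega
    · have e : (subProds L).countP (fun a => g * a ∈ H)
          ≤ (subProds L).countP (fun a => ¬ a ∈ H) := by
        rw [Multiset.countP_eq_card_filter, Multiset.countP_eq_card_filter]
        apply Multiset.card_le_card
        apply Multiset.monotone_filter_right
        intro x hx hxH
        exact hg ((H.mul_mem_cancel_right hxH).1 hx)
      have e2 := Multiset.card_eq_countP_add_countP (fun a => a ∈ H) (subProds L)
      omega

theorem prod_notMem {G ι : Type*} [Group G] (H : Subgroup G) (f : ι → G) (i₀ : ι)
    (h₀ : f i₀ ∉ H) (h : ∀ i, i ≠ i₀ → f i ∈ H) (l : List ι) (hl : l.Nodup) (hi : i₀ ∈ l) :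
    (l.map f).prod ∉ H := by
  induction l with
  | nil => simp at hi
  | cons a l ih =>
    rw [List.map_cons, List.prod_cons]
    rw [List.nodup_cons] at hl
    by_cases ha : a = i₀
    · subst ha
      have : (l.map f).prod ∈ H := by
        apply Subgroup.list_prod_mem
        intro x hx
        obtain ⟨i, hi', rfl⟩ := List.mem_map.1 hx
        apply h
        rintro rfl
        exact hl.1 hi'
      rw [H.mul_mem_cancel_right this]
      exact h₀
    · rw [H.mul_mem_cancel_left (h a ha)]
      apply ih hl.2
      rcases List.mem_cons.1 hi with h | h
      · exact absurd h.symm ha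
      · exact h

/-- The affine hash. -/
def hsh (q : ℕ) (w : ZMod q × ZMod q) (i : ℕ) : ZMod q := w.1 * i + w.2

theorem sum_one (q : ℕ) [Fact q.Prime] (F : ZMod q → ℤ) (i : ℕ) :
    ∑ w : ZMod q × ZMod q, F (hsh q w i) = q * ∑ x, F x := by
  rw [Fintype.sum_prod_type]
  have : ∀ a : ZMod q, ∑ c, F (hsh q (a, c) i) = ∑ x, F x := fun a =>
    Equiv.sum_comp (Equiv.addLeft (a * (i : ZMod q))) F
  simp [this, ZMod.card]

theorem sum_two (q : ℕ) [Fact q.Prime] (F G : ZMod q → ℤ) (i j : ℕ) (hi : i < q) (hj : j < q)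
    (hij : i ≠ j) :
    ∑ w : ZMod q × ZMod q, F (hsh q w i) * G (hsh q w j) = (∑ x, F x) * ∑ x, G x := by
  have hne : (i : ZMod q) - j ≠ 0 := by
    intro h
    rw [sub_eq_zero, ZMod.natCast_eq_natCast_iff'] at h
    rw [Nat.mod_eq_of_lt hi, Nat.mod_eq_of_lt hj] at h
    exact hij h
  have hinj : Function.Injective (fun w : ZMod q × ZMod q => (hsh q w i, hsh q w j)) := by
    rintro ⟨a, c⟩ ⟨a', c'⟩ h
    simp only [hsh, Prod.mk.injEq] at h
    obtain ⟨h1, h2⟩ := h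
    have : (a - a') * ((i : ZMod q) - j) = 0 := by linear_combination h1 - h2
    have ha : a = a' := by
      rcases mul_eq_zero.1 this with h | h
      · exact sub_eq_zero.1 h
      · exact absurd h hne
    subst ha
    simpa using h1
  have hb := Finite.injective_iff_bijective.1 hinj
  rw [Finset.sum_mul_sum, ← Fintype.sum_prod_type']
  exact Equiv.sum_comp (Equiv.ofBijective _ hb) (fun p : ZMod q × ZMod q => F p.1 * G p.2)

theorem sum_quad (q k : ℕ) [Fact q.Prime] (hk : k ≤ q) (B : Finset (Fin k)) (F G : ZMod q → ℤ) :
    ∑ w : ZMod q × ZMod q, (∑ i ∈ B, F (hsh q w i)) * (∑ i ∈ B, G (hsh q w i))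
      = B.card * (B.card - 1) * ((∑ x, F x) * ∑ x, G x) + B.card * (q * ∑ x, F x * G x) := by
  simp_rw [Finset.sum_mul_sum]
  rw [Finset.sum_comm]
  have : ∀ i ∈ B, ∑ w : ZMod q × ZMod q, ∑ j ∈ B, F (hsh q w i) * G (hsh q w j)
      = (B.card - 1) * ((∑ x, F x) * ∑ x, G x) + q * ∑ x, F x * G x := by
    intro i hi
    rw [Finset.sum_comm, ← Finset.sum_erase_add _ _ hi]
    congr 1
    · rw [Finset.sum_congr rfl (g := fun _ => (∑ x, F x) * ∑ x, G x)]
      · have : 1 ≤ B.card := Finset.card_pos.2 ⟨i, hi⟩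
        rw [Finset.sum_const, Finset.card_erase_of_mem hi]
        simp [Nat.cast_sub this]
      · intro j hj
        apply sum_two q F G i j (by omega) (by omega)
        intro h
        exact (Finset.ne_of_mem_erase hj) (Fin.ext h.symm)
    · exact sum_one q (fun x => F x * G x) i
  rw [Finset.sum_congr rfl this, Finset.sum_const, nsmul_eq_mul, ← Finset.sum_mul_sum]
  ring

theorem sum_lt (q : ℕ) [Fact q.Prime] (s : ℕ) (hs : s ≤ q) :
    ∑ x : ZMod q, (if x.val < s then 1 else 0 : ℤ) = s := by
  obtain ⟨n, rfl⟩ : ∃ n, q = n + 1 := ⟨q - 1, by have := (Fact.out : q.Prime).pos; omega⟩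
  change ∑ x : Fin (n + 1), (if (x : ℕ) < s then 1 else 0 : ℤ) = s
  rw [Fin.sum_univ_eq_sum_range (fun x => (if x < s then 1 else 0 : ℤ)), Finset.sum_boole]
  congr 1
  rw [show (Finset.range (n + 1)).filter (fun x => x < s) = Finset.range s by
    ext x; simp; omega]
  simp

theorem ind_ineq (n m : ℕ) : 2 * (n : ℤ) + 2 * m - n * n - m * m - n * m
    ≤ if n = 1 ∨ n + m = 1 then 1 else 0 := by
  rcases Nat.lt_or_ge n 2 with h | h
  · interval_cases n
    · rcases Nat.lt_or_ge m 2 with h | h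
      · interval_cases m <;> simp
      · rw [if_neg (by omega)]
        have : (2 : ℤ) ≤ m := by exact_mod_cast h
        push_cast
        nlinarith
    · simp only [true_or, if_true]
      have : (0 : ℤ) ≤ m := by positivity
      rcases Nat.eq_zero_or_pos m with rfl | h
      · simp
      · have : (1 : ℤ) ≤ m := by exact_mod_cast h
        push_cast
        nlinarith
  · rw [if_neg (by omega)]
    have : (2 : ℤ) ≤ n := by exact_mod_cast h
    have : (0 : ℤ) ≤ m := by positivity
    nlinarith

/-- Number of elements of `B` hashed below `t`. -/
def cnt (q k : ℕ) (B : Finset (Fin k)) (t : ℕ) (w : ZMod q × ZMod q) : ℕ :=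
  (B.filter (fun i : Fin k => (hsh q w i).val < t)).card

theorem good_count (q k : ℕ) [Fact q.Prime] (hk : k ≤ q) (B : Finset (Fin k)) (s : ℕ)
    (h1 : q ≤ 4 * (B.card * s)) (h2 : 2 * (B.card * s) ≤ q) (hs : 2 * s ≤ q) :
    q * q ≤ 4 * ((Finset.univ : Finset (ZMod q × ZMod q)).filter
      (fun w => cnt q k B s w = 1 ∨ cnt q k B (2 * s) w = 1)).card := by
  set F : ZMod q → ℤ := fun x => if x.val < s then 1 else 0 with hF
  set G : ZMod q → ℤ := fun x => (if x.val < 2 * s then 1 else 0) - F x with hG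
  have sF : ∑ x, F x = s := sum_lt q s (by omega)
  have sG : ∑ x, G x = s := by
    simp only [hG, Finset.sum_sub_distrib, sF, sum_lt q (2 * s) hs]
    push_cast; ring
  have eFF : ∀ x, F x * F x = F x := by intro x; simp only [hF]; split_ifs <;> simp
  have eGG : ∀ x, G x * G x = G x := by
    intro x; simp only [hG, hF]; split_ifs <;> first | omega | simp
  have eFG : ∀ x, F x * G x = 0 := by
    intro x; simp only [hG, hF]; split_ifs <;> first | omega | simp
  have c1 : ∀ w, ((cnt q k B s w : ℕ) : ℤ) = ∑ i ∈ B, F (hsh q w i) := by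
    intro w; simp [cnt, hF, Finset.sum_boole]
  have c2 : ∀ w, ((cnt q k B (2 * s) w : ℕ) : ℤ)
      = ∑ i ∈ B, F (hsh q w i) + ∑ i ∈ B, G (hsh q w i) := by
    intro w; rw [← Finset.sum_add_distrib]; simp [cnt, hG, Finset.sum_boole]
  have hle : ∀ w, cnt q k B s w ≤ cnt q k B (2 * s) w := by
    intro w
    apply Finset.card_le_card
    apply Finset.monotone_filter_right
    intro i _ h
    omega
  have key : ∑ w : ZMod q × ZMod q, (2 * (∑ i ∈ B, F (hsh q w i)) + 2 * (∑ i ∈ B, G (hsh q w i))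
      - (∑ i ∈ B, F (hsh q w i)) * (∑ i ∈ B, F (hsh q w i))
      - (∑ i ∈ B, G (hsh q w i)) * (∑ i ∈ B, G (hsh q w i))
      - (∑ i ∈ B, F (hsh q w i)) * (∑ i ∈ B, G (hsh q w i)))
      ≤ ∑ w : ZMod q × ZMod q,
        (if cnt q k B s w = 1 ∨ cnt q k B (2 * s) w = 1 then 1 else 0 : ℤ) := by
    apply Finset.sum_le_sum
    intro w _
    have := ind_ineq (cnt q k B s w) (cnt q k B (2 * s) w - cnt q k B s w)
    rw [Nat.cast_sub (hle w), Nat.add_sub_cancel' (hle w), c1, c2, add_sub_cancel_left] at this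
    exact this
  rw [Finset.sum_boole] at key
  simp only [Finset.sum_sub_distrib, Finset.sum_add_distrib, ← Finset.mul_sum,
    sum_quad q k hk, eFF, eGG, eFG, sF, sG] at key
  have lin : ∀ K : ZMod q → ℤ, ∑ w : ZMod q × ZMod q, ∑ i ∈ B, K (hsh q w i)
      = B.card * (q * ∑ x, K x) := by
    intro K
    rw [Finset.sum_comm]
    simp [sum_one]
  rw [lin, lin, sF, sG] at key
  simp only [Finset.sum_const_zero] at key
  generalize ((Finset.univ : Finset (ZMod q × ZMod q)).filter
      (fun w => cnt q k B s w = 1 ∨ cnt q k B (2 * s) w = 1)).card = N at *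
  zify at h1 h2 ⊢
  have hb : (0 : ℤ) ≤ B.card * (s * s) := by positivity
  clear lin
  generalize (B.card : ℤ) = b at *
  generalize (s : ℤ) = s' at *
  generalize (q : ℤ) = q' at *
  nlinarith [mul_nonneg (sub_nonneg.2 h1) (sub_nonneg.2 h2), mul_nonneg (sub_nonneg.2 h2) (sub_nonneg.2 h2)]

/-- The list of test elements for a hash seed. -/
noncomputable def tests (q k m : ℕ) (w : ZMod q × ZMod q) : List (FreeGroup (Fin k)) :=
  (List.range m).map (fun j => ((List.finRange k).map (fun i : Fin k =>
    if (hsh q w i).val < 2 ^ j then FreeGroup.of i else 1)).prod)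

theorem tests_good (q k m : ℕ) (w : ZMod q × ZMod q) (H : Subgroup (FreeGroup (Fin k)))
    (j : ℕ) (hj : j < m)
    (h : cnt q k (Finset.univ.filter (fun i : Fin k => FreeGroup.of i ∉ H)) (2 ^ j) w = 1) :
    ∃ g ∈ tests q k m w, g ∉ H := by
  refine ⟨_, List.mem_map.2 ⟨j, List.mem_range.2 hj, rfl⟩, ?_⟩
  obtain ⟨i₀, hi₀⟩ := Finset.card_eq_one.1 h
  have hiff : ∀ i : Fin k, (FreeGroup.of i ∉ H ∧ (hsh q w i).val < 2 ^ j) ↔ i = i₀ := by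
    intro i
    have := Finset.ext_iff.1 hi₀ i
    simpa using this
  apply prod_notMem H _ i₀ _ _ _ (List.nodup_finRange k) (List.mem_finRange i₀)
  · have := (hiff i₀).2 rfl
    rw [if_pos this.2]; exact this.1
  · intro i hi
    have := mt (hiff i).1 hi
    split_ifs with hc
    · by_contra h'
      exact this ⟨h', hc⟩
    · exact H.one_mem

theorem stmt7 (k : ℕ) (hk : 2 ≤ k) :
    ∃ A : Multiset (FreeGroup (Fin k)), A ≠ 0 ∧
      Multiset.card A ≤ 61 * k ^ 13 ∧ Detects A (1 / 8) := by
  obtain ⟨q, hq, hq1, hq2⟩ := Nat.exists_prime_lt_and_le_two_mul (2 * k) (by omega)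
  have : Fact q.Prime := ⟨hq⟩
  set m := Nat.log 2 q + 1 with hm
  set A : Multiset (FreeGroup (Fin k)) :=
    ∑ w : ZMod q × ZMod q, subProds (tests q k m w) with hA
  have hlen : ∀ w, Multiset.card (subProds (tests q k m w)) = 2 ^ m := by
    intro w; rw [card_subProds]; simp [tests]
  have hcard : Multiset.card A = q * q * 2 ^ m := by
    rw [hA, Multiset.card_sum]
    simp [hlen, ZMod.card]
  have h2m : 2 ^ m ≤ 2 * q := by
    rw [hm, pow_succ]
    have := Nat.pow_log_le_self 2 hq.ne_zero
    omega
  refine ⟨A, ?_, ?_, ?_⟩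
  · rw [← Multiset.card_pos, hcard]
    have := hq.pos
    positivity
  · rw [hcard]
    have hq4 : q ≤ 4 * k := by omega
    calc q * q * 2 ^ m ≤ (4 * k) * (4 * k) * (2 * (4 * k)) := by
          gcongr; omega
      _ = 128 * k ^ 3 := by ring
      _ ≤ 61 * 2 ^ 10 * k ^ 3 := by gcongr; norm_num
      _ ≤ 61 * k ^ 10 * k ^ 3 := by gcongr
      _ = 61 * k ^ 13 := by ring
  · intro H hH
    set B : Finset (Fin k) := Finset.univ.filter (fun i : Fin k => FreeGroup.of i ∉ H) with hB
    have hBpos : 0 < B.card := by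
      rw [Finset.card_pos]
      by_contra hne
      rw [Finset.not_nonempty_iff_eq_empty, hB, Finset.filter_eq_empty_iff] at hne
      apply hH
      rw [eq_top_iff, ← FreeGroup.closure_range_of, Subgroup.closure_le]
      rintro _ ⟨i, rfl⟩
      simpa using hne (Finset.mem_univ i)
    have hBk : B.card ≤ k := by simpa using Finset.card_le_univ B
    -- choose the scale
    have hdiv : 2 ≤ q / B.card := by
      rw [Nat.le_div_iff_mul_le hBpos]; omega
    set j := Nat.log 2 (q / B.card) with hj
    have hj1 : 1 ≤ j := Nat.log_pos (by norm_num) hdiv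
    have l1 : 2 ^ j * B.card ≤ q := by
      rw [← Nat.le_div_iff_mul_le hBpos]
      exact Nat.pow_log_le_self 2 (by omega)
    have l2 : q < 2 ^ (j + 1) * B.card := by
      rw [← Nat.div_lt_iff_lt_mul hBpos]
      exact Nat.lt_pow_succ_log_self (by norm_num) _
    have hjm : j < m := by
      have : j ≤ Nat.log 2 q := Nat.log_mono_right (Nat.div_le_self _ _)
      omega
    obtain ⟨i, hi⟩ : ∃ i, j = i + 1 := ⟨j - 1, by omega⟩
    rw [hi] at l1 l2 hjm
    have e1 : 2 ^ (i + 1) = 2 * 2 ^ i := by ring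
    have e2 : 2 ^ (i + 1 + 1) = 4 * 2 ^ i := by ring
    rw [e1] at l1
    rw [e2] at l2
    have hgood := good_count q k (by omega) B (2 ^ i) (by nlinarith) (by nlinarith) (by nlinarith)
    set S := (Finset.univ : Finset (ZMod q × ZMod q)).filter
      (fun w => cnt q k B (2 ^ i) w = 1 ∨ cnt q k B (2 * 2 ^ i) w = 1) with hS
    have hw : ∀ w : ZMod q × ZMod q,
        2 * (subProds (tests q k m w)).countP (fun a => a ∈ H) + (if w ∈ S then 2 ^ m else 0)
          ≤ 2 * 2 ^ m := by
      intro w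
      split_ifs with hwS
      · have hex : ∃ g ∈ tests q k m w, g ∉ H := by
          rcases (Finset.mem_filter.1 hwS).2 with h | h
          · exact tests_good q k m w H i (by omega) h
          · exact tests_good q k m w H (i + 1) hjm (by rw [e1]; exact h)
        have := subProds_half H _ hex
        rw [hlen] at this
        omega
      · have := Multiset.countP_le_card (fun a => a ∈ H) (subProds (tests q k m w))
        rw [hlen] at this
        omega
    have hsum := Finset.sum_le_sum (fun w (_ : w ∈ (Finset.univ : Finset (ZMod q × ZMod q))) => hw w)
    rw [Finset.sum_add_distrib, ← Finset.mul_sum] at hsum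
    have hc : ∑ w : ZMod q × ZMod q, (subProds (tests q k m w)).countP (fun a => a ∈ H)
        = A.countP (fun a => a ∈ H) := by
      rw [hA]
      exact (map_sum (Multiset.countPAddMonoidHom (fun a => a ∈ H)) _ _).symm
    rw [hc] at hsum
    have hs2 : ∑ w : ZMod q × ZMod q, (if w ∈ S then 2 ^ m else 0) = S.card * 2 ^ m := by
      simp [Finset.sum_ite_mem]
    rw [hs2] at hsum
    have hs3 : ∑ w : ZMod q × ZMod q, 2 * 2 ^ m = q * q * (2 * 2 ^ m) := by
      simp [ZMod.card]
    rw [hs3] at hsum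
    rw [← Multiset.countP_eq_card_filter, hcard]
    have hfin : 8 * A.countP (fun a => a ∈ H) ≤ 7 * (q * q * 2 ^ m) := by
      nlinarith [Nat.mul_le_mul_right (2 ^ m) hgood]
    have : (8 : ℝ) * (A.countP (fun a => a ∈ H) : ℕ) ≤ 7 * ((q * q * 2 ^ m : ℕ) : ℝ) := by
      exact_mod_cast hfin
    linarith
end

section
/- There exists a real constant C ≥ 1 such that for every integer k ≥ 4, the free group F_k on k generators has a finite nonempty multiset A with |A| ≤ C·k·(log₂ k)^13, such that every element of A has reduced word length at most C·k·(log₂ k)·(log₂ log₂ k) in the generators, and A has detection probability at least 1/32 in F_k. -/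
open scoped Classical

namespace Det

/-- Sampling lemma: `8n` samples suffice for at most `2^n` events of probability at least `1/2`. -/
theorem sampling {Ω ι : Type} [Fintype Ω] [Fintype ι] (n : ℕ) (hn : 1 ≤ n)
    (hι : Fintype.card ι ≤ 2 ^ n) (hΩ : 0 < Fintype.card Ω) (E : ι → Finset Ω)
    (hE : ∀ i, Fintype.card Ω ≤ 2 * (E i).card) :
    ∃ ω : Fin (8 * n) → Ω, ∀ i, 2 * n ≤ (Finset.univ.filter (fun a => ω a ∈ E i)).card := by
  by_contra hcon
  push Not at hcon
  let bad : ι → Finset (Fin (8 * n) → Ω) := fun i =>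
    Finset.univ.filter (fun ω => (Finset.univ.filter (fun a => ω a ∈ E i)).card < 2 * n)
  have hcover : (Finset.univ : Finset (Fin (8 * n) → Ω)) ⊆ Finset.univ.biUnion bad := by
    intro ω _
    obtain ⟨i, hi⟩ := hcon ω
    simp only [Finset.mem_biUnion, bad, Finset.mem_filter]
    exact ⟨i, Finset.mem_univ _, Finset.mem_univ _, hi⟩
  have hbad : ∀ i, (bad i).card * 2 ^ (14 * n) ≤ (3 * Fintype.card Ω) ^ (8 * n) := by
    intro i
    have h1 : (bad i).card * 2 ^ (6 * n) ≤
        ∑ ω : Fin (8 * n) → Ω, ∏ a, (if ω a ∈ E i then 1 else 2) := by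
      rw [← smul_eq_mul, ← Finset.sum_const]
      refine le_trans (Finset.sum_le_sum ?_) (Finset.sum_le_sum_of_subset (Finset.subset_univ (bad i)))
      intro ω hω
      simp only [bad, Finset.mem_filter] at hω
      rw [Finset.prod_ite]
      simp only [Finset.prod_const, one_pow, one_mul]
      apply Nat.pow_le_pow_right (by norm_num)
      have := Finset.card_filter_add_card_filter_not (s := (Finset.univ : Finset (Fin (8 * n))))
        (fun a => ω a ∈ E i)
      simp only [Finset.card_univ, Fintype.card_fin] at this
      omega
    rw [← Fintype.sum_pow (fun o => if o ∈ E i then 1 else 2) (8 * n)] at h1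
    have h2 : 2 * (∑ o : Ω, if o ∈ E i then 1 else 2) ≤ 3 * Fintype.card Ω := by
      rw [Finset.sum_ite]
      have := Finset.card_filter_add_card_filter_not (s := (Finset.univ : Finset Ω))
        (fun a => a ∈ E i)
      have h3 := hE i
      have h4 : (Finset.univ.filter (fun a => a ∈ E i)) = E i := by ext; simp
      rw [h4] at this ⊢
      simp only [Finset.card_univ] at this
      simp only [Finset.sum_const, smul_eq_mul]
      omega
    calc (bad i).card * 2 ^ (14 * n) = 2 ^ (8 * n) * ((bad i).card * 2 ^ (6 * n)) := by
          rw [show 14 * n = 8 * n + 6 * n by ring, pow_add]; ring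
      _ ≤ 2 ^ (8 * n) * (∑ o : Ω, if o ∈ E i then 1 else 2) ^ (8 * n) :=
          Nat.mul_le_mul_left _ h1
      _ = (2 * (∑ o : Ω, if o ∈ E i then 1 else 2)) ^ (8 * n) := by rw [mul_pow]
      _ ≤ _ := Nat.pow_le_pow_left h2 _
  have h5 : Fintype.card Ω ^ (8 * n) ≤ ∑ i, (bad i).card := by
    have := (Finset.card_le_card hcover).trans Finset.card_biUnion_le
    simpa using this
  have h6 : Fintype.card Ω ^ (8 * n) * 2 ^ (14 * n) ≤ 2 ^ n * (3 * Fintype.card Ω) ^ (8 * n) := by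
    calc _ ≤ (∑ i, (bad i).card) * 2 ^ (14 * n) := Nat.mul_le_mul_right _ h5
      _ = ∑ i, (bad i).card * 2 ^ (14 * n) := Finset.sum_mul _ _ _
      _ ≤ ∑ i : ι, (3 * Fintype.card Ω) ^ (8 * n) := Finset.sum_le_sum (fun i _ => hbad i)
      _ = Fintype.card ι * (3 * Fintype.card Ω) ^ (8 * n) := by simp
      _ ≤ _ := Nat.mul_le_mul_right _ hι
  have h7 : Fintype.card Ω ^ (8 * n) * 2 ^ (14 * n) ≤
      Fintype.card Ω ^ (8 * n) * (2 ^ n * 3 ^ (8 * n)) := by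
    rw [mul_pow] at h6
    linarith
  have h8 := Nat.le_of_mul_le_mul_left h7 (pow_pos hΩ _)
  rw [pow_mul, pow_mul 3, ← mul_pow] at h8
  have h9 : (2 * 3 ^ 8) ^ n < (2 ^ 14) ^ n := Nat.pow_lt_pow_left (by norm_num) (by omega)
  omega

/-- The number of hash functions isolating an element of `B`. -/
theorem iso_count (n Q : ℕ) (z : Fin Q) (B : Finset (Fin n)) (h1 : 2 * B.card ≤ Q)
    (h2 : Q ≤ 4 * B.card) :
    Q ^ n ≤ 8 * (Finset.univ.filter (fun f : Fin n → Fin Q =>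
      ((Finset.univ.filter (fun i => f i = z)) ∩ B).card = 1)).card := by
  let P : Fin n → Finset (Fin n → Fin Q) := fun i =>
    Fintype.piFinset (fun j => if j = i then {z} else if j ∈ B then Finset.univ.erase z
      else Finset.univ)
  have hsub : B.biUnion P ⊆ (Finset.univ.filter (fun f : Fin n → Fin Q =>
      ((Finset.univ.filter (fun i => f i = z)) ∩ B).card = 1)) := by
    intro f hf
    simp only [Finset.mem_biUnion, P, Fintype.mem_piFinset] at hf
    obtain ⟨i, hi, hf⟩ := hf
    simp only [Finset.mem_filter, Finset.mem_univ, true_and]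
    rw [Finset.card_eq_one]
    refine ⟨i, ?_⟩
    ext j
    have hj := hf j
    simp only [Finset.mem_inter, Finset.mem_filter, Finset.mem_univ, true_and,
      Finset.mem_singleton]
    by_cases hji : j = i
    · subst hji
      simp at hj
      simp [hj, hi]
    · simp only [hji, iff_false]
      rintro ⟨ha, hb⟩
      simp [hji, hb] at hj
      exact hj ha
  have hdisj : (B : Set (Fin n)).PairwiseDisjoint P := by
    intro i hi j hj hij
    rw [Function.onFun, Finset.disjoint_left]
    intro f hf hf'
    simp only [P, Fintype.mem_piFinset] at hf hf'
    have a := hf i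
    have b := hf' i
    have hi' : i ∈ B := hi
    simp at a
    simp [hij, hi'] at b
    exact b a
  have hcard : ∀ i ∈ B, (P i).card = (Q - 1) ^ (B.card - 1) * Q ^ (n - B.card) := by
    intro i hi
    simp only [P, Fintype.card_piFinset]
    rw [← Finset.prod_mul_prod_compl B, ← Finset.mul_prod_erase B _ hi]
    have e1 : ∏ x ∈ B.erase i, (if x = i then ({z} : Finset (Fin Q)) else if x ∈ B then
        Finset.univ.erase z else Finset.univ).card = ∏ x ∈ B.erase i, (Q - 1) := by
      apply Finset.prod_congr rfl
      intro x hx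
      rw [Finset.mem_erase] at hx
      simp [hx.1, hx.2]
    have e2 : ∏ x ∈ Bᶜ, (if x = i then ({z} : Finset (Fin Q)) else if x ∈ B then
        Finset.univ.erase z else Finset.univ).card = ∏ x ∈ Bᶜ, Q := by
      apply Finset.prod_congr rfl
      intro x hx
      rw [Finset.mem_compl] at hx
      have : x ≠ i := by rintro rfl; exact hx hi
      simp [this, hx]
    rw [e1, e2]
    simp [Finset.card_erase_of_mem hi, Finset.card_compl]
  have hle := Finset.card_le_card hsub
  rw [Finset.card_biUnion hdisj, Finset.sum_congr rfl hcard, Finset.sum_const, smul_eq_mul] at hle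
  refine le_trans ?_ (Nat.mul_le_mul_left 8 hle)
  have hbn : B.card ≤ n := by simpa using Finset.card_le_univ B
  have hQ : 0 < Q := z.pos
  obtain ⟨b, hb⟩ : ∃ b, B.card = b + 1 := ⟨B.card - 1, by omega⟩
  rw [hb] at h1 h2 hbn ⊢
  have key : Q ^ (b + 1) ≤ 8 * ((b + 1) * (Q - 1) ^ b) := by
    have hber : (Q : ℝ) ^ b ≤ 2 * ((Q : ℝ) - 1) ^ b := by
      have hQr : (0 : ℝ) < Q := by exact_mod_cast hQ
      have h2b : (2 : ℝ) * (b + 1) ≤ Q := by exact_mod_cast h1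
      have hb0 : (0 : ℝ) ≤ b := Nat.cast_nonneg b
      have := one_add_mul_le_pow (a := -(1 / (Q : ℝ))) (by
        have : 1 / (Q : ℝ) ≤ 1 := by rw [div_le_one hQr]; linarith
        linarith) b
      have h3 : (1 : ℝ) / 2 ≤ 1 + b * -(1 / (Q : ℝ)) := by
        have : (b : ℝ) * (1 / Q) ≤ 1 / 2 := by
          rw [mul_one_div, div_le_iff₀ hQr]; linarith
        linarith
      have h4 : ((Q : ℝ) - 1) = Q * (1 + -(1 / (Q : ℝ))) := by field_simp; ring
      rw [h4, mul_pow]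
      have h5 : (0 : ℝ) < (Q : ℝ) ^ b := by positivity
      nlinarith
    have hnat : Q ^ b ≤ 2 * (Q - 1) ^ b := by
      have : ((Q - 1 : ℕ) : ℝ) = (Q : ℝ) - 1 := by
        rw [Nat.cast_sub (by omega)]; simp
      rw [← this] at hber
      exact_mod_cast hber
    calc Q ^ (b + 1) = Q * Q ^ b := by ring
      _ ≤ (4 * (b + 1)) * (2 * (Q - 1) ^ b) := Nat.mul_le_mul h2 hnat
      _ = _ := by ring
  calc Q ^ n = Q ^ (b + 1) * Q ^ (n - (b + 1)) := by rw [← pow_add]; congr 1; omega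
    _ ≤ (8 * ((b + 1) * (Q - 1) ^ b)) * Q ^ (n - (b + 1)) := Nat.mul_le_mul_right _ key
    _ = _ := by simp; ring

/-- Isolating families at one scale. -/
theorem scale (n : ℕ) (hn : 1 ≤ n) (Q : ℕ) (hQ : 0 < Q) :
    ∃ S : Fin (8 * n) → Fin 6 → Finset (Fin n), ∀ B : Finset (Fin n),
      2 * B.card ≤ Q → Q ≤ 4 * B.card →
      2 * n ≤ (Finset.univ.filter (fun a => ∃ r, (S a r ∩ B).card = 1)).card := by
  let z : Fin Q := ⟨0, hQ⟩
  let Iso : Finset (Fin n) → Finset (Fin n → Fin Q) := fun B =>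
    Finset.univ.filter (fun f : Fin n → Fin Q =>
      ((Finset.univ.filter (fun i => f i = z)) ∩ B).card = 1)
  let I := {B : Finset (Fin n) // 2 * B.card ≤ Q ∧ Q ≤ 4 * B.card}
  have hI : Fintype.card I ≤ 2 ^ n := by
    refine (Fintype.card_subtype_le _).trans ?_
    simp
  have : Nonempty (Fin Q) := ⟨z⟩
  obtain ⟨ω, hω⟩ := sampling (Ω := Fin 6 → Fin n → Fin Q) (ι := I) n hn hI Fintype.card_pos
    (fun B => Finset.univ.filter (fun F => ∃ r, F r ∈ Iso B.1)) (by
      rintro ⟨B, h1, h2⟩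
      have hc := iso_count n Q z B h1 h2
      have hcompl : (Finset.univ.filter (fun F : Fin 6 → Fin n → Fin Q => ¬ ∃ r, F r ∈ Iso B))
          = Fintype.piFinset (fun _ => (Iso B)ᶜ) := by
        ext F; simp
      have hs := Finset.card_filter_add_card_filter_not
        (s := (Finset.univ : Finset (Fin 6 → Fin n → Fin Q))) (fun F => ∃ r, F r ∈ Iso B)
      rw [hcompl, Fintype.card_piFinset] at hs
      simp only [Finset.prod_const, Finset.card_univ, Fintype.card_fin] at hs
      have hT : Fintype.card (Fin n → Fin Q) = Q ^ n := by simp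
      have hT6 : Fintype.card (Fin 6 → Fin n → Fin Q) = (Q ^ n) ^ 6 := by simp
      have hcc : (Iso B)ᶜ.card + (Iso B).card = Q ^ n := by
        rw [← hT, Finset.card_compl_add_card]
      have h8 : 8 * (Iso B)ᶜ.card ≤ 7 * Q ^ n := by
        have : Q ^ n ≤ 8 * (Iso B).card := hc
        omega
      have h9 := Nat.pow_le_pow_left h8 6
      rw [mul_pow, mul_pow] at h9
      rw [hT6] at hs ⊢
      simp only
      omega)
  refine ⟨fun a r => Finset.univ.filter (fun i => ω a r i = z), ?_⟩
  intro B h1 h2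
  have := hω ⟨B, h1, h2⟩
  simpa [Iso] using this

/-- Isolating families at all scales. -/
theorem step (n : ℕ) (hn : 1 ≤ n) :
    ∃ S : Fin (8 * n) → Fin (6 * (Nat.log 2 n + 1)) → Finset (Fin n), ∀ B : Finset (Fin n),
      B.Nonempty →
      2 * n ≤ (Finset.univ.filter (fun a => ∃ r, (S a r ∩ B).card = 1)).card := by
  choose S hS using fun j : ℕ => scale n hn (2 ^ (j + 2)) (by positivity)
  let e : Fin 6 × Fin (Nat.log 2 n + 1) ≃ Fin (6 * (Nat.log 2 n + 1)) := finProdFinEquiv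
  refine ⟨fun a r => S (e.symm r).2 a (e.symm r).1, ?_⟩
  intro B hB
  have hb : B.card ≠ 0 := by simpa using hB.ne_empty
  have hbn : B.card ≤ n := by simpa using Finset.card_le_univ B
  have l1 := Nat.pow_log_le_self 2 hb
  have l2 := Nat.lt_pow_succ_log_self (b := 2) (by norm_num) B.card
  have l3 : Nat.log 2 B.card ≤ Nat.log 2 n := Nat.log_mono_right hbn
  refine (hS (Nat.log 2 B.card) B ?_ ?_).trans (Finset.card_le_card ?_)
  · simp only [pow_succ] at l2 ⊢; omega
  · simp only [pow_succ] at l2 ⊢; omega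
  · intro a ha
    simp only [Finset.mem_filter, Finset.mem_univ, true_and] at ha ⊢
    obtain ⟨r, hr⟩ := ha
    exact ⟨e (r, ⟨Nat.log 2 B.card, by omega⟩), by simpa using hr⟩

/-- Product of the subfamily indexed by `S`, in increasing order. -/
noncomputable def sub {G : Type} [Group G] {n : ℕ} (x : Fin n → G) (S : Finset (Fin n)) : G :=
  (((List.finRange n).filter (fun i => i ∈ S)).map x).prod

theorem sub_not_mem {G : Type} [Group G] {n : ℕ} (x : Fin n → G) (S : Finset (Fin n))
    (H : Subgroup G) (h : (S ∩ Finset.univ.filter (fun i => x i ∉ H)).card = 1) :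
    sub x S ∉ H := by
  rw [Finset.card_eq_one] at h
  obtain ⟨i, hi⟩ := h
  have hmem : ∀ j, (j ∈ S ∧ x j ∉ H) ↔ j = i := by
    intro j
    have := Finset.ext_iff.1 hi j
    simpa using this
  unfold sub
  have hil : i ∈ (List.finRange n).filter (fun i => i ∈ S) := by
    simpa using ((hmem i).2 rfl).1
  have hnd : ((List.finRange n).filter (fun i => i ∈ S)).Nodup := (List.nodup_finRange n).filter _
  have hall : ∀ j ∈ (List.finRange n).filter (fun i => i ∈ S), j ∈ S := by
    intro j hj; simpa using hj
  generalize (List.finRange n).filter (fun i => i ∈ S) = l at hil hnd hall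
  obtain ⟨l1, l2, rfl⟩ := List.append_of_mem hil
  have p1 : (l1.map x).prod ∈ H := by
    apply Subgroup.list_prod_mem
    intro y hy
    obtain ⟨j, hj, rfl⟩ := List.mem_map.1 hy
    by_contra hc
    have := (hmem j).1 ⟨hall j (by simp [hj]), hc⟩
    subst this
    rw [List.nodup_append] at hnd
    exact hnd.2.2 j hj j (by simp) rfl
  have p2 : (l2.map x).prod ∈ H := by
    apply Subgroup.list_prod_mem
    intro y hy
    obtain ⟨j, hj, rfl⟩ := List.mem_map.1 hy
    by_contra hc
    have := (hmem j).1 ⟨hall j (by simp [hj]), hc⟩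
    subst this
    have := (List.nodup_append.1 hnd).2.1
    rw [List.nodup_cons] at this
    exact this.1 hj
  simp only [List.map_append, List.map_cons, List.prod_append, List.prod_cons]
  rw [H.mul_mem_cancel_left p1, H.mul_mem_cancel_right p2]
  exact ((hmem i).2 rfl).2

theorem half {G : Type} [Group G] (H : Subgroup G) (l : List G) :
    (∃ y ∈ l, y ∉ H) → ∀ g : G,
      2 * (l.sublists'.countP (fun s => g * s.prod ∈ H)) ≤ 2 ^ l.length := by
  induction l with
  | nil => simp
  | cons x l ih =>
    intro hex g
    rw [List.sublists'_cons, List.countP_append, List.countP_map, List.length_cons, pow_succ]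
    by_cases hl : ∃ y ∈ l, y ∉ H
    · have a := ih hl g
      have b := ih hl (g * x)
      simp only [Function.comp_def, List.prod_cons, ← mul_assoc]
      omega
    · push Not at hl
      have hx : x ∉ H := by
        obtain ⟨y, hy, hyH⟩ := hex
        rcases List.mem_cons.1 hy with rfl | hy
        · exact hyH
        · exact absurd (hl y hy) hyH
      have hp : ∀ s ∈ l.sublists', s.prod ∈ H := by
        intro s hs
        rw [List.mem_sublists'] at hs
        exact Subgroup.list_prod_mem _ (fun y hy => hl y (hs.subset hy))
      have c1 := List.countP_le_length (p := fun s : List G => decide (g * s.prod ∈ H))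
        (l := l.sublists')
      have c2 := List.countP_le_length
        (p := (fun s : List G => decide (g * s.prod ∈ H)) ∘ List.cons x) (l := l.sublists')
      rw [List.length_sublists'] at c1 c2
      by_cases hg : g ∈ H
      · have : l.sublists'.countP ((fun s : List G => decide (g * s.prod ∈ H)) ∘ List.cons x) = 0 := by
          rw [List.countP_eq_zero]
          intro s hs
          simp only [Function.comp, decide_eq_true_eq]
          rw [List.prod_cons, H.mul_mem_cancel_left hg, H.mul_mem_cancel_right (hp s hs)]
          exact hx
        omega
      · have : l.sublists'.countP (fun s : List G => decide (g * s.prod ∈ H)) = 0 := by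
          rw [List.countP_eq_zero]
          intro s hs
          simp only [decide_eq_true_eq]
          rw [H.mul_mem_cancel_right (hp s hs)]
          exact hg
        omega

/-- A word construction turning `n` elements into `N` elements, multiplying lengths by at most
`ℓ`, with detection probability at least `1/q`. -/
def Good (G : Type) [Group G] (len : G → ℕ) (n N ℓ q : ℕ) : Prop :=
  ∃ D : (Fin n → G) → Multiset G, (∀ x, Multiset.card (D x) = N) ∧
    (∀ x m, (∀ i, len (x i) ≤ m) → ∀ w ∈ D x, len w ≤ ℓ * m) ∧
    ∀ (H : Subgroup G) x, (∃ i, x i ∉ H) → N ≤ q * (D x).countP (fun a => a ∉ H)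

theorem len_prod {G : Type} [Group G] (len : G → ℕ) (h1 : len 1 = 0)
    (hm : ∀ a b, len (a * b) ≤ len a + len b) (m : ℕ) (l : List G) (hl : ∀ y ∈ l, len y ≤ m) :
    len l.prod ≤ l.length * m := by
  induction l with
  | nil => simp [h1]
  | cons x l ih =>
    rw [List.prod_cons, List.length_cons]
    have a := hm x l.prod
    have b := ih (fun y hy => hl y (List.mem_cons_of_mem _ hy))
    have c := hl x (by simp)
    linarith

theorem good_base (G : Type) [Group G] (len : G → ℕ) (h1 : len 1 = 0)
    (hm : ∀ a b, len (a * b) ≤ len a + len b) (n : ℕ) : Good G len n (2 ^ n) n 2 := by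
  refine ⟨fun x => ((List.ofFn x).sublists'.map List.prod : List G), ?_, ?_, ?_⟩
  · intro x; simp
  · intro x m hx w hw
    simp only [Multiset.mem_coe, List.mem_map, List.mem_sublists'] at hw
    obtain ⟨s, hs, rfl⟩ := hw
    refine (len_prod len h1 hm m s ?_).trans (Nat.mul_le_mul_right _ ?_)
    · intro y hy
      have := hs.subset hy
      rw [List.mem_ofFn] at this
      obtain ⟨i, rfl⟩ := this
      exact hx i
    · simpa using hs.length_le
  · rintro H x ⟨i, hi⟩
    have h := half H (List.ofFn x) ⟨x i, by simp, hi⟩ 1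
    simp only [one_mul, List.length_ofFn] at h
    simp only [Multiset.coe_countP, List.countP_map]
    have h2 := List.length_eq_countP_add_countP (fun s : List G => decide (s.prod ∈ H))
      (l := (List.ofFn x).sublists')
    simp only [List.length_sublists', List.length_ofFn] at h2
    have h3 : (List.ofFn x).sublists'.countP ((fun a : G => decide (a ∉ H)) ∘ List.prod) =
      (List.ofFn x).sublists'.countP (fun s => decide ¬ (decide (s.prod ∈ H) = true)) := by
      congr 1
      ext s
      simp
    rw [h3]
    omega

theorem good_lift (G : Type) [Group G] (len : G → ℕ) (h1 : len 1 = 0)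
    (hm : ∀ a b, len (a * b) ≤ len a + len b) (n N ℓ q : ℕ) (hn : 1 ≤ n)
    (h : Good G len (6 * (Nat.log 2 n + 1)) N ℓ q) : Good G len n (8 * n * N) (n * ℓ) (4 * q) := by
  obtain ⟨D, hc, hl, hd⟩ := h
  obtain ⟨S, hS⟩ := step n hn
  refine ⟨fun x => ∑ a : Fin (8 * n), D (fun r => sub x (S a r)), ?_, ?_, ?_⟩
  · intro x
    simp [hc]
  · intro x m hx w hw
    rw [Multiset.mem_sum] at hw
    obtain ⟨a, -, hw⟩ := hw
    have := hl _ (n * m) ?_ w hw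
    · calc _ ≤ _ := this
        _ = _ := by ring
    · intro r
      unfold sub
      refine (len_prod len h1 hm m _ ?_).trans (Nat.mul_le_mul_right _ ?_)
      · intro y hy
        obtain ⟨i, -, rfl⟩ := List.mem_map.1 hy
        exact hx i
      · rw [List.length_map]
        exact (List.length_filter_le _ _).trans (by simp)
  · rintro H x ⟨i, hi⟩
    have hB := hS (Finset.univ.filter (fun i => x i ∉ H)) ⟨i, by simpa using hi⟩
    have hsum : Multiset.countP (fun a => a ∉ H) (∑ a : Fin (8 * n), D (fun r => sub x (S a r))) =
        ∑ a : Fin (8 * n), Multiset.countP (fun a => a ∉ H) (D (fun r => sub x (S a r))) := by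
      exact map_sum (Multiset.countPAddMonoidHom (fun a : G => a ∉ H)) _ _
    rw [hsum]
    set T := Finset.univ.filter
      (fun a => ∃ r, (S a r ∩ Finset.univ.filter (fun i => x i ∉ H)).card = 1) with hT
    have hsub : ∑ a ∈ T, q * Multiset.countP (fun a => a ∉ H) (D (fun r => sub x (S a r))) ≤
        ∑ a : Fin (8 * n), q * Multiset.countP (fun a => a ∉ H) (D (fun r => sub x (S a r))) :=
      Finset.sum_le_sum_of_subset (Finset.subset_univ T)
    have hT2 : T.card * N ≤
        ∑ a ∈ T, q * Multiset.countP (fun a => a ∉ H) (D (fun r => sub x (S a r))) := by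
      rw [← smul_eq_mul, ← Finset.sum_const]
      apply Finset.sum_le_sum
      intro a ha
      simp only [hT, Finset.mem_filter, Finset.mem_univ, true_and] at ha
      obtain ⟨r, hr⟩ := ha
      exact hd H _ ⟨r, sub_not_mem x _ H hr⟩
    rw [← Finset.mul_sum, ← Finset.mul_sum] at hsub
    rw [← Finset.mul_sum] at hT2
    have hB' : 2 * n * N ≤ T.card * N := Nat.mul_le_mul_right _ hB
    calc 8 * n * N = 4 * (2 * n * N) := by ring
      _ ≤ 4 * (q * ∑ a : Fin (8 * n), Multiset.countP (fun a => a ∉ H)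
          (D (fun r => sub x (S a r)))) := Nat.mul_le_mul_left _ (hB'.trans (hT2.trans hsub))
      _ = _ := by ring

theorem log_bound (m : ℕ) (hm : 1 ≤ m) : (Nat.log 2 m : ℝ) ≤ Real.logb 2 m := by
  rw [Real.le_logb_iff_rpow_le (by norm_num) (by exact_mod_cast hm), Real.rpow_natCast]
  exact_mod_cast Nat.pow_log_le_self 2 (by omega)

end Det

set_option maxHeartbeats 1000000 in
theorem stmt8 :
    ∃ C : ℝ, 1 ≤ C ∧
      ∀ k : ℕ, 4 ≤ k →
        ∃ A : Multiset (FreeGroup (Fin k)), A ≠ 0 ∧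
          (Multiset.card A : ℝ) ≤ C * k * (Real.logb 2 k) ^ 13 ∧
          (∀ w ∈ A, ((FreeGroup.toWord w).length : ℝ) ≤
            C * k * Real.logb 2 k * Real.logb 2 (Real.logb 2 k)) ∧
          Detects A (1 / 32) := by
  refine ⟨64 * 12 * 24 ^ 6, by norm_num, ?_⟩
  intro k hk
  set L1 := 6 * (Nat.log 2 k + 1) with hL1
  set L2 := 6 * (Nat.log 2 L1 + 1) with hL2
  have hL1pos : 1 ≤ L1 := by omega
  have h1 : FreeGroup.norm (1 : FreeGroup (Fin k)) = 0 := FreeGroup.norm_one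
  have hm : ∀ a b : FreeGroup (Fin k),
      FreeGroup.norm (a * b) ≤ FreeGroup.norm a + FreeGroup.norm b := FreeGroup.norm_mul_le
  have g2 := Det.good_base (FreeGroup (Fin k)) FreeGroup.norm h1 hm L2
  have g1 := Det.good_lift _ _ h1 hm L1 _ _ _ hL1pos g2
  have g0 := Det.good_lift _ _ h1 hm k _ _ _ (by omega) g1
  obtain ⟨D, hc, hl, hd⟩ := g0
  -- numerical facts
  set x := Real.logb 2 k with hx
  have hkr : (4 : ℝ) ≤ k := by exact_mod_cast hk
  have hx2 : 2 ≤ x := by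
    rw [hx, Real.le_logb_iff_rpow_le (by norm_num) (by linarith)]
    norm_num
    exact hk
  have hL1x : (L1 : ℝ) ≤ 12 * x := by
    have := Det.log_bound k (by omega)
    rw [hL1]; push_cast
    linarith
  have hL1r : (1 : ℝ) ≤ L1 := by exact_mod_cast hL1pos
  set y := Real.logb 2 x with hy
  have hy1 : 1 ≤ y := by
    rw [hy, Real.le_logb_iff_rpow_le (by norm_num) (by linarith)]
    simpa using hx2
  have hL2y : (L2 : ℝ) ≤ 36 * y := by
    have a := Det.log_bound L1 hL1pos
    have b : Real.logb 2 L1 ≤ 4 + y := by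
      have : Real.logb 2 L1 ≤ Real.logb 2 (2 ^ (4 : ℕ) * x) :=
        Real.logb_le_logb_of_le (by norm_num) (by linarith) (by linarith)
      rw [Real.logb_mul (by norm_num) (by linarith), Real.logb_pow,
        Real.logb_self_eq_one (by norm_num)] at this
      push_cast at this
      linarith
    rw [hL2]; push_cast
    linarith
  have hpow : (2 : ℝ) ^ L2 ≤ (24 * x) ^ 6 := by
    have : 2 ^ (Nat.log 2 L1 + 1) ≤ 2 * L1 := by
      have := Nat.pow_log_le_self 2 (x := L1) (by omega)
      rw [pow_succ]; omega
    have h2 : (2 : ℝ) ^ (Nat.log 2 L1 + 1) ≤ 2 * L1 := by exact_mod_cast this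
    rw [hL2, mul_comm, pow_mul]
    apply pow_le_pow_left₀ (by positivity)
    linarith
  clear_value y x L2 L1
  have hcard := hc FreeGroup.of
  refine ⟨D FreeGroup.of, ?_, ?_, ?_, ?_⟩
  · intro h0
    rw [h0] at hcard
    have : 0 < 8 * k * (8 * L1 * 2 ^ L2) :=
      Nat.mul_pos (by omega) (Nat.mul_pos (by omega) (Nat.two_pow_pos _))
    rw [← hcard, Multiset.card_zero] at this
    exact lt_irrefl _ this
  · rw [hcard]
    push_cast
    calc (8 : ℝ) * k * (8 * L1 * 2 ^ L2) = 64 * k * (L1 * 2 ^ L2) := by ring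
      _ ≤ 64 * k * ((12 * x) * (24 * x) ^ 6) := by gcongr
      _ = 64 * 12 * 24 ^ 6 * k * x ^ 7 := by ring
      _ ≤ 64 * 12 * 24 ^ 6 * k * x ^ 13 := by
        gcongr
        · linarith
        · norm_num
  · intro w hw
    have := hl FreeGroup.of 1 (fun i => by simp [FreeGroup.norm_of]) w hw
    have h2 : ((FreeGroup.toWord w).length : ℝ) ≤ (k * (L1 * L2) * 1 : ℕ) := by
      exact_mod_cast this
    refine h2.trans ?_
    push_cast
    have hk0 : (0 : ℝ) ≤ k := by linarith
    calc (k : ℝ) * (L1 * L2) * 1 ≤ k * ((12 * x) * (36 * y)) * 1 := by gcongr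
      _ = 432 * (k * x * y) := by ring
      _ ≤ (64 * 12 * 24 ^ 6) * (k * x * y) := by
        apply mul_le_mul_of_nonneg_right (by norm_num) (by positivity)
      _ = _ := by ring
  · intro H hH
    have hex : ∃ i, (FreeGroup.of i : FreeGroup (Fin k)) ∉ H := by
      by_contra hcon
      push Not at hcon
      apply hH
      rw [eq_top_iff, ← FreeGroup.closure_range_of, Subgroup.closure_le]
      rintro _ ⟨i, rfl⟩
      exact hcon i
    have := hd H FreeGroup.of hex
    have hs := Multiset.card_eq_countP_add_countP (fun a => a ∈ H) (D FreeGroup.of)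
    rw [← Multiset.countP_eq_card_filter]
    rw [← hcard] at this
    have t1 : ((Multiset.card (D FreeGroup.of) : ℕ) : ℝ) ≤
        32 * (Multiset.countP (fun a => a ∉ H) (D FreeGroup.of) : ℕ) := by
      exact_mod_cast this
    have t2 : ((Multiset.card (D FreeGroup.of) : ℕ) : ℝ) =
        (Multiset.countP (fun a => a ∈ H) (D FreeGroup.of) : ℕ) +
        (Multiset.countP (fun a => a ∉ H) (D FreeGroup.of) : ℕ) := by
      exact_mod_cast hs
    linarith
end

section
/- There exist a real number α > 0 and a positive integer n₀ such that for every real δ with 0 < δ ≤ α/4 and every integer k ≥ n₀ the following holds: if there exists a finite multiset A of elements of the free group F_k with |A| = 4k and detection probability at least δ in F_k, then there exists a finite multiset A' of elements of the free group F_{2k} with |A'| = 8k and detection probability at least δ in F_{2k}. -/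
open scoped Classical

lemma choose_mul_pow_le (n s : ℕ) : (n.choose s : ℝ) * (s : ℝ) ^ s ≤ (3 * n : ℝ) ^ s := by
  have h1 : (n.choose s : ℝ) ≤ (n : ℝ) ^ s / (s.factorial : ℝ) := Nat.choose_le_pow_div s n
  have h2 : (s : ℝ) ^ s / (s.factorial : ℝ) ≤ Real.exp s :=
    Real.pow_div_factorial_le_exp (s : ℝ) (by positivity) s
  have h3 : Real.exp s ≤ 3 ^ s := by
    have : Real.exp (s : ℝ) = Real.exp 1 ^ s := by rw [← Real.exp_nat_mul, mul_one]
    rw [this]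
    exact pow_le_pow_left₀ (Real.exp_pos _).le (by linarith [Real.exp_one_lt_d9]) s
  calc (n.choose s : ℝ) * (s : ℝ) ^ s ≤ (n : ℝ) ^ s / (s.factorial : ℝ) * (s : ℝ) ^ s := by gcongr
    _ = (n : ℝ) ^ s * ((s : ℝ) ^ s / (s.factorial : ℝ)) := by ring
    _ ≤ (n : ℝ) ^ s * 3 ^ s := by gcongr; exact h2.trans h3
    _ = _ := by rw [mul_pow]; ring

lemma num_bound (m s : ℕ) (hs : 1 ≤ s) (hm : 3000 * s ≤ m) :
    ((2 * m).choose s : ℝ) * (m.choose (3 * s) : ℝ) * ((3 * s : ℕ) : ℝ) ^ (5 * s) * 2 ^ s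
      ≤ (m : ℝ) ^ (5 * s) := by
  have h1 := choose_mul_pow_le (2 * m) s
  have h2 := choose_mul_pow_le m (3 * s)
  have hs0 : (0 : ℝ) < s := by exact_mod_cast hs
  have hm' : (3000 : ℝ) * s ≤ m := by exact_mod_cast hm
  have hpos : (0 : ℝ) < (s : ℝ) ^ s := by positivity
  refine le_of_mul_le_mul_right ?_ hpos
  calc ((2 * m).choose s : ℝ) * (m.choose (3 * s) : ℝ) * ((3 * s : ℕ) : ℝ) ^ (5 * s) * 2 ^ s
        * (s : ℝ) ^ s
      = (((2 * m).choose s : ℝ) * (s : ℝ) ^ s) *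
        ((m.choose (3 * s) : ℝ) * ((3 * s : ℕ) : ℝ) ^ (3 * s)) *
          (((3 * s : ℕ) : ℝ) ^ (2 * s) * 2 ^ s) := by
        rw [show 5 * s = 3 * s + 2 * s by ring, pow_add]; ring
    _ ≤ (3 * (2 * m : ℕ) : ℝ) ^ s * (3 * m : ℝ) ^ (3 * s) *
          (((3 * s : ℕ) : ℝ) ^ (2 * s) * 2 ^ s) := by gcongr
    _ = (2916 * s * ((m : ℝ) ^ 4 * s)) ^ s := by
        rw [pow_mul, pow_mul, ← mul_pow, ← mul_pow, ← mul_pow]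
        push_cast
        congr 1
        ring
    _ ≤ (m * ((m : ℝ) ^ 4 * s)) ^ s := by
        gcongr
        linarith
    _ = (m : ℝ) ^ (5 * s) * (s : ℝ) ^ s := by
        rw [pow_mul, ← mul_pow]; congr 1; ring

lemma card_bad (n m : ℕ) (S : Finset (Fin n)) (T : Finset (Fin m)) :
    ((Finset.univ.filter (fun f : Fin n × Fin 5 → Fin m =>
      ∀ i ∈ S, ∀ e, f (i, e) ∈ T)).card) * m ^ (5 * S.card)
      = T.card ^ (5 * S.card) * m ^ (n * 5) := by
  have : (Finset.univ.filter (fun f : Fin n × Fin 5 → Fin m =>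
      ∀ i ∈ S, ∀ e, f (i, e) ∈ T)) =
      Fintype.piFinset (fun p : Fin n × Fin 5 => if p.1 ∈ S then T else Finset.univ) := by
    ext f
    simp only [Finset.mem_filter, Finset.mem_univ, true_and, Fintype.mem_piFinset, Prod.forall]
    refine forall_congr' fun i => ?_
    by_cases h : i ∈ S <;> simp [h]
  rw [this, Fintype.card_piFinset, Fintype.prod_prod_type]
  have h2 : ∀ i : Fin n, (∏ e : Fin 5, (if (i, e).1 ∈ S then T else Finset.univ).card)
      = if i ∈ S then T.card ^ 5 else m ^ 5 := by
    intro i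
    by_cases h : i ∈ S <;> simp [h]
  rw [Finset.prod_congr rfl (fun i _ => h2 i), Finset.prod_ite]
  simp only [Finset.prod_const, Finset.filter_mem_eq_inter, Finset.univ_inter]
  have h3 : S.card + (Finset.univ.filter (fun i => i ∉ S)).card = n := by
    have := Finset.card_filter_add_card_filter_not (s := (Finset.univ : Finset (Fin n)))
      (fun i => i ∈ S)
    simpa using this
  set c := (Finset.univ.filter (fun i => i ∉ S)).card
  have h4 : m ^ (n * 5) = m ^ ((S.card + c) * 5) := by rw [h3]
  rw [h4, add_mul, pow_add, ← pow_mul, ← pow_mul]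
  ring

lemma exists_expander (m : ℕ) (hm : 1 ≤ m) : ∃ f : Fin (2 * m) × Fin 5 → Fin m,
    ∀ S : Finset (Fin (2 * m)), ∀ T : Finset (Fin m), 1 ≤ S.card → 3000 * S.card ≤ m →
      T.card = 3 * S.card → ¬ (∀ i ∈ S, ∀ e, f (i, e) ∈ T) := by
  by_contra hcon
  push Not at hcon
  let B : Finset (Fin (2 * m)) × Finset (Fin m) → Finset (Fin (2 * m) × Fin 5 → Fin m) :=
    fun p => Finset.univ.filter (fun f => ∀ i ∈ p.1, ∀ e, f (i, e) ∈ p.2)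
  let I : ℕ → Finset (Finset (Fin (2 * m)) × Finset (Fin m)) := fun s =>
    (Finset.powersetCard s Finset.univ) ×ˢ (Finset.powersetCard (3 * s) Finset.univ)
  let R := Finset.Ico 1 (m / 3000 + 1)
  have hcover : (Finset.univ : Finset (Fin (2 * m) × Fin 5 → Fin m)) ⊆
      R.biUnion (fun s => (I s).biUnion B) := by
    intro f _
    obtain ⟨S, T, h1, h2, h3, h4⟩ := hcon f
    simp only [Finset.mem_biUnion]
    refine ⟨S.card, ?_, (S, T), ?_, ?_⟩
    · simp only [R, Finset.mem_Ico]; omega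
    · simp [I, h3]
    · simpa [B] using h4
  have hle := (Finset.card_le_card hcover).trans Finset.card_biUnion_le
  have hmpos : (0 : ℝ) < m := by exact_mod_cast hm
  have hterm : ∀ s ∈ R, ((((I s).biUnion B).card : ℕ) : ℝ) ≤ (m : ℝ) ^ (2 * m * 5) * (1 / 2) ^ s := by
    intro s hs
    simp only [R, Finset.mem_Ico] at hs
    have hnum := num_bound m s hs.1 (by omega)
    have hB : ∀ p ∈ I s, ((B p).card : ℝ) =
        ((3 * s : ℕ) : ℝ) ^ (5 * s) * (m : ℝ) ^ (2 * m * 5) / (m : ℝ) ^ (5 * s) := by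
      intro p hp
      simp only [I, Finset.mem_product, Finset.mem_powersetCard_univ] at hp
      have := card_bad (2 * m) m p.1 p.2
      rw [hp.1, hp.2] at this
      rw [eq_div_iff (by positivity)]
      exact_mod_cast this
    have h1 : ((((I s).biUnion B).card : ℕ) : ℝ) ≤ ∑ p ∈ I s, ((B p).card : ℝ) := by
      exact_mod_cast Finset.card_biUnion_le
    rw [Finset.sum_congr rfl hB, Finset.sum_const] at h1
    have hI : (I s).card = (2 * m).choose s * m.choose (3 * s) := by
      simp [I, Finset.card_product, Finset.card_powersetCard]
    rw [hI, nsmul_eq_mul] at h1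
    refine h1.trans ?_
    rw [← mul_div_assoc, div_le_iff₀ (by positivity), one_div, inv_pow]
    have h2 : (0 : ℝ) < 2 ^ s := by positivity
    refine le_of_mul_le_mul_right ?_ h2
    calc _ = (((2 * m).choose s : ℝ) * (m.choose (3 * s) : ℝ) * ((3 * s : ℕ) : ℝ) ^ (5 * s) * 2 ^ s)
            * (m : ℝ) ^ (2 * m * 5) := by push_cast; ring
      _ ≤ (m : ℝ) ^ (5 * s) * (m : ℝ) ^ (2 * m * 5) := by gcongr
      _ = _ := by field_simp
  have hsum : ∀ N : ℕ, ∑ s ∈ Finset.Ico 1 (N + 1), ((1 : ℝ) / 2) ^ s = 1 - (1 / 2) ^ N := by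
    intro N
    induction N with
    | zero => simp
    | succ N ih => rw [Finset.sum_Ico_succ_top (by omega), ih]; ring
  have hle' : (m : ℝ) ^ (2 * m * 5) ≤ ∑ s ∈ R, ((((I s).biUnion B).card : ℕ) : ℝ) := by
    have : (Finset.univ : Finset (Fin (2 * m) × Fin 5 → Fin m)).card = m ^ (2 * m * 5) := by
      simp [Finset.card_univ]
    rw [this] at hle
    exact_mod_cast hle
  have h5 := hle'.trans (Finset.sum_le_sum hterm)
  rw [← Finset.mul_sum, hsum] at h5
  have h6 : (0 : ℝ) < (m : ℝ) ^ (2 * m * 5) := by positivity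
  have h7 : (0 : ℝ) < (1 / 2 : ℝ) ^ (m / 3000) := by positivity
  nlinarith [mul_pos h6 h7]

lemma exists_unique_expander (m : ℕ) (hm : 1 ≤ m) : ∃ f : Fin (2 * m) × Fin 5 → Fin m,
    ∀ S : Finset (Fin (2 * m)), 3000 * S.card ≤ m →
      S.card ≤ (Finset.univ.filter (fun j : Fin m =>
        ((Finset.univ.filter (fun p : Fin (2 * m) × Fin 5 => p.1 ∈ S ∧ f p = j)).card = 1))).card := by
  obtain ⟨f, hf⟩ := exists_expander m hm
  refine ⟨f, fun S hS => ?_⟩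
  rcases Nat.eq_zero_or_pos S.card with h0 | hpos
  · omega
  let E : Finset (Fin (2 * m) × Fin 5) := S ×ˢ Finset.univ
  have hN : 3 * S.card ≤ (E.image f).card := by
    by_contra hlt
    push Not at hlt
    obtain ⟨T, hT1, -, hT2⟩ := Finset.exists_subsuperset_card_eq
      (Finset.subset_univ (E.image f)) hlt.le (by rw [Finset.card_univ, Fintype.card_fin]; omega)
    refine hf S T hpos hS hT2 (fun i hi e => hT1 ?_)
    exact Finset.mem_image_of_mem f (by simp [E, hi])
  let c : Fin m → ℕ := fun j =>
    (Finset.univ.filter (fun p : Fin (2 * m) × Fin 5 => p.1 ∈ S ∧ f p = j)).card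
  have hc : ∀ j, c j = (E.filter (fun p => f p = j)).card := by
    intro j
    refine congrArg Finset.card ?_
    ext p
    simp [E]
  have hsum : ∑ j, c j = 5 * S.card := by
    simp only [hc]
    rw [← Finset.card_eq_sum_card_fiberwise (f := f) (s := E) (t := Finset.univ) (by simp)]
    simp [E, Finset.card_product, mul_comm]
  have hpt : ∀ j, 2 * (if j ∈ E.image f then 1 else 0) ≤ c j + (if c j = 1 then 1 else 0) := by
    intro j
    by_cases hj : j ∈ E.image f
    · have : 0 < c j := by
        rw [hc, Finset.card_pos]
        obtain ⟨p, hp, rfl⟩ := Finset.mem_image.1 hj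
        exact ⟨p, by simp [hp]⟩
      rw [if_pos hj]
      split_ifs <;> omega
    · simp [hj]
  have := Finset.sum_le_sum (fun j (_ : j ∈ Finset.univ) => hpt j)
  rw [← Finset.mul_sum, Finset.sum_add_distrib, hsum, ← Finset.card_filter, ← Finset.card_filter] at this
  have h8 : (Finset.univ.filter (fun j => j ∈ E.image f)) = E.image f := by ext; simp
  rw [h8] at this
  change S.card ≤ (Finset.univ.filter (fun j => c j = 1)).card
  omega

lemma prod_not_mem {G : Type*} [Group G] (H : Subgroup G) (l : List G)
    (h : l.countP (fun g => decide (g ∉ H)) = 1) : l.prod ∉ H := by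
  induction l with
  | nil => simp at h
  | cons a l ih =>
    rw [List.prod_cons]
    by_cases ha : a ∈ H
    · rw [List.countP_cons_of_neg (by simpa using ha)] at h
      rw [H.mul_mem_cancel_left ha]
      exact ih h
    · rw [List.countP_cons_of_pos (by simpa using ha)] at h
      have h0 : l.countP (fun g => decide (g ∉ H)) = 0 := by omega
      rw [List.countP_eq_zero] at h0
      have : l.prod ∈ H := H.list_prod_mem (fun x hx => by simpa using h0 x hx)
      rwa [H.mul_mem_cancel_right this]

/-- number of indices whose value avoids `H` -/
noncomputable def outCount {G ι : Type*} [Group G] [Fintype ι] (g : ι → G) (H : Subgroup G) : ℕ :=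
  (Finset.univ.filter (fun i => g i ∉ H)).card

lemma exists_words (m : ℕ) (hm : 1 ≤ m) {G : Type*} [Group G] (g : Fin (2 * m) → G) :
    ∃ z : Fin m → G, ∀ H : Subgroup G, 3000 * outCount g H ≤ m →
      outCount g H ≤ outCount z H := by
  obtain ⟨f, hf⟩ := exists_unique_expander m hm
  refine ⟨fun j => (((Finset.univ.filter (fun p => f p = j)).toList).map (fun p => g p.1)).prod, ?_⟩
  intro H hH
  refine (hf _ hH).trans (Finset.card_le_card ?_)
  intro j hj
  simp only [Finset.mem_filter, Finset.mem_univ, true_and] at hj ⊢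
  apply prod_not_mem
  rw [List.countP_map, ← hj]
  change List.countP (fun p : Fin (2 * m) × Fin 5 => decide (g p.1 ∉ H)) _ = _
  rw [← Multiset.coe_countP, Finset.coe_toList, Multiset.countP_eq_card_filter,
    ← Finset.filter_val, Finset.card_val, Finset.filter_filter]
  congr 1
  ext p
  simp [and_comm]

lemma detects_iff {G ι : Type*} [Group G] [Fintype ι] (g : ι → G) (δ : ℝ) :
    Detects ((Finset.univ : Finset ι).val.map g) δ ↔
      ∀ H : Subgroup G, H ≠ ⊤ → δ * Fintype.card ι ≤ outCount g H := by
  unfold Detects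
  refine forall_congr' fun H => forall_congr' fun _ => ?_
  have h := Finset.card_filter_add_card_filter_not (s := (Finset.univ : Finset ι))
      (fun i => g i ∈ H)
  have h' : ((Finset.univ.filter (fun i => g i ∈ H)).card : ℝ) + outCount g H = Fintype.card ι := by
    exact_mod_cast h
  have h2 : (Multiset.filter (fun a => a ∈ H) ((Finset.univ : Finset ι).val.map g)).card =
      (Finset.univ.filter (fun i => g i ∈ H)).card := by
    rw [Multiset.filter_map, Multiset.card_map]; rfl
  rw [h2, Multiset.card_map, Finset.card_val, Finset.card_univ]
  constructor <;> intro h <;> linarith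

lemma exists_index {G : Type*} (A : Multiset G) (n : ℕ) (h : Multiset.card A = n) :
    ∃ g : Fin n → G, A = (Finset.univ : Finset (Fin n)).val.map g := by
  subst h
  induction A using Quotient.inductionOn with
  | h l =>
    refine ⟨l.get, ?_⟩
    have := Fin.univ_val_map (l.get)
    rw [List.ofFn_get] at this
    exact this.symm

lemma outCount_sum {G ι κ : Type*} [Group G] [Fintype ι] [Fintype κ] (g : ι → G) (g' : κ → G)
    (H : Subgroup G) : outCount (Sum.elim g g') H = outCount g H + outCount g' H := by
  unfold outCount
  simp only [Finset.card_filter, Fintype.sum_sum_type, Sum.elim_inl, Sum.elim_inr]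
  congr!

theorem stmt10 :
    ∃ α : ℝ, 0 < α ∧ ∃ n₀ : ℕ, 0 < n₀ ∧
      ∀ δ : ℝ, 0 < δ → δ ≤ α / 4 →
        ∀ k : ℕ, n₀ ≤ k →
          (∃ A : Multiset (FreeGroup (Fin k)),
            Multiset.card A = 4 * k ∧ Detects A δ) →
          ∃ A' : Multiset (FreeGroup (Fin (2 * k))),
            Multiset.card A' = 8 * k ∧ Detects A' δ := by
  refine ⟨1 / 6000, by norm_num, 1, one_pos, ?_⟩
  rintro δ hδ hδ' k hk ⟨A, hA, hdet⟩
  obtain ⟨a, rfl⟩ := exists_index A (2 * (2 * k)) (by omega)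
  rw [detects_iff] at hdet
  let x : Fin (2 * k) → FreeGroup (Fin (2 * k)) := FreeGroup.of
  obtain ⟨y, hy⟩ := exists_words k hk x
  let φ : FreeGroup (Fin k) →* FreeGroup (Fin (2 * k)) := FreeGroup.lift y
  let b : Fin (2 * (2 * k)) → FreeGroup (Fin (2 * k)) := fun i => φ (a i)
  obtain ⟨z, hz⟩ := exists_words (2 * k) (by omega) b
  refine ⟨(Finset.univ : Finset (Fin (2 * k) ⊕ (Fin (2 * (2 * k)) ⊕ Fin (2 * k)))).val.map
    (Sum.elim x (Sum.elim b z)), ?_, ?_⟩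
  · rw [Multiset.card_map, Finset.card_val, Finset.card_univ]
    simp only [Fintype.card_sum, Fintype.card_fin]
    ring
  rw [detects_iff]
  intro H hH
  rw [outCount_sum, outCount_sum]
  simp only [Fintype.card_sum, Fintype.card_fin] at hdet ⊢
  push_cast at hdet ⊢
  have hkpos : (1 : ℝ) ≤ k := by exact_mod_cast hk
  have hsmall : 8 * δ * k * 3000 ≤ k := by nlinarith
  by_cases h1 : 8 * δ * k ≤ outCount x H
  · have : (0 : ℝ) ≤ outCount b H := by positivity
    have : (0 : ℝ) ≤ outCount z H := by positivity
    linarith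
  by_cases h2 : 8 * δ * k ≤ outCount b H
  · have : (0 : ℝ) ≤ outCount x H := by positivity
    have : (0 : ℝ) ≤ outCount z H := by positivity
    linarith
  push Not at h1 h2
  have hx1 : 3000 * outCount x H ≤ k := by
    have : (3000 : ℝ) * outCount x H ≤ k := by linarith
    exact_mod_cast this
  have hb1 : 3000 * outCount b H ≤ 2 * k := by
    have : (3000 : ℝ) * outCount b H ≤ 2 * k := by linarith
    exact_mod_cast this
  have hxy := hy H hx1
  have hbz := hz H hb1
  have hxpos : 0 < outCount x H := by
    by_contra h0
    have h0 : outCount x H = 0 := by omega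
    apply hH
    rw [eq_top_iff, ← FreeGroup.closure_range_of, Subgroup.closure_le]
    rintro _ ⟨i, rfl⟩
    by_contra hi
    have : i ∈ Finset.univ.filter (fun i => x i ∉ H) := by simpa using hi
    rw [outCount, Finset.card_eq_zero] at h0
    simp [h0] at this
  have hcomap : H.comap φ ≠ ⊤ := by
    intro htop
    have hy0 : outCount y H = 0 := by
      rw [outCount, Finset.card_eq_zero, Finset.filter_eq_empty_iff]
      intro j _
      have : FreeGroup.of j ∈ H.comap φ := by rw [htop]; trivial
      simpa [φ] using this
    omega
  have hd := hdet _ hcomap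
  have hbe : outCount a (H.comap φ) = outCount b H := rfl
  rw [hbe] at hd
  have hbz' : (outCount b H : ℝ) ≤ outCount z H := by exact_mod_cast hbz
  have : (0 : ℝ) ≤ outCount x H := by positivity
  linarith
end

section
/- There exist real constants δ > 0, C > 0 and a positive integer e such that for every positive integer k, the free group F_k on k generators has a finite nonempty multiset A with |A| ≤ 8·k, such that every element of A has reduced word length at most C·k^e in the generators, and A has detection probability at least δ in F_k. (Consequently, every group of rank k has such a test subset.) -/
open scoped Classical

/-- The permutations mapping `S` into `T`. -/
noncomputable def permsInto {α : Type} [Fintype α] (S T : Finset α) : Finset (Equiv.Perm α) :=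
  Finset.univ.filter (fun π => ∀ a ∈ S, π a ∈ T)

lemma permsInto_step {α : Type} [Fintype α] (S T : Finset α) (a : α) (ha : a ∉ S) :
    Fintype.card α * (permsInto (insert a S) T).card ≤ T.card * (permsInto S T).card := by
  have h1 : ∀ b : α, (permsInto (insert a S) T).card ≤ (permsInto (insert b S) T).card := by
    intro b
    by_cases hb : b ∈ S
    · apply Finset.card_le_card
      intro π
      simp only [permsInto, Finset.mem_filter, Finset.mem_univ, true_and]
      intro h c hc
      rw [Finset.insert_eq_of_mem hb] at hc
      exact h c (Finset.mem_insert_of_mem hc)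
    · apply Finset.card_le_card_of_injOn (fun π => π * Equiv.swap a b)
      · intro π
        simp only [permsInto, Finset.coe_filter, Finset.mem_univ, true_and, Set.mem_ofPred_eq]
        intro h c hc
        rw [Equiv.Perm.mul_apply]
        rcases Finset.mem_insert.1 hc with rfl | hc
        · rw [Equiv.swap_apply_right]
          exact h a (Finset.mem_insert_self _ _)
        · rw [Equiv.swap_apply_of_ne_of_ne]
          · exact h c (Finset.mem_insert_of_mem hc)
          · exact fun h => ha (h ▸ hc)
          · exact fun h => hb (h ▸ hc)
      · intro π _ π' _ h
        exact mul_right_cancel h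
  have h2 : ∑ b : α, (permsInto (insert b S) T).card = T.card * (permsInto S T).card := by
    have h3 : ∀ b : α, (permsInto (insert b S) T).card
        = ∑ π ∈ permsInto S T, if π b ∈ T then 1 else 0 := by
      intro b
      rw [← Finset.card_filter]
      congr 1
      ext π
      simp only [permsInto, Finset.mem_filter, Finset.mem_univ, true_and, Finset.mem_insert,
        forall_eq_or_imp]
      tauto
    simp_rw [h3]
    rw [Finset.sum_comm]
    have h4 : ∀ π : Equiv.Perm α, (∑ b : α, if π b ∈ T then 1 else 0) = T.card := by
      intro π
      rw [Equiv.sum_comp π (fun b => if b ∈ T then 1 else 0)]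
      simp
    simp_rw [h4]
    simp [mul_comm]
  calc Fintype.card α * (permsInto (insert a S) T).card
      = ∑ b : α, (permsInto (insert a S) T).card := by simp
    _ ≤ _ := Finset.sum_le_sum (fun b _ => h1 b)
    _ = _ := h2

lemma permsInto_card {α : Type} [Fintype α] (S T : Finset α) :
    Fintype.card α ^ S.card * (permsInto S T).card
      ≤ T.card ^ S.card * Nat.card (Equiv.Perm α) := by
  induction S using Finset.induction_on with
  | empty => simp [permsInto]
  | insert a S ha ih =>
    rw [Finset.card_insert_of_notMem ha, pow_succ, pow_succ]
    calc _ = Fintype.card α ^ S.card * (Fintype.card α * (permsInto (insert a S) T).card) := by ring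
      _ ≤ Fintype.card α ^ S.card * (T.card * (permsInto S T).card) :=
        Nat.mul_le_mul_left _ (permsInto_step S T a ha)
      _ = T.card * (Fintype.card α ^ S.card * (permsInto S T).card) := by ring
      _ ≤ T.card * (T.card ^ S.card * Nat.card (Equiv.Perm α)) := Nat.mul_le_mul_left _ ih
      _ = _ := by ring

lemma choose_bound (n k : ℕ) (hk : 0 < k) : (n.choose k : ℝ) ≤ (3 * n / k) ^ k := by
  have hk' : (0 : ℝ) < k := by exact_mod_cast hk
  have h1 : (k : ℝ) ^ k / k.factorial ≤ 3 ^ k := by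
    refine (Real.pow_div_factorial_le_exp (x := (k : ℝ)) hk'.le k).trans ?_
    have : Real.exp (k : ℝ) = Real.exp 1 ^ k := by rw [← Real.exp_nat_mul]; simp
    rw [this]
    exact pow_le_pow_left₀ (Real.exp_pos _).le
      (Real.exp_one_lt_d9.le.trans (by norm_num)) k
  have hf : (0 : ℝ) < k.factorial := by exact_mod_cast k.factorial_pos
  refine (Nat.choose_le_pow_div (α := ℝ) k n).trans ?_
  rw [div_pow, mul_pow, div_le_div_iff₀ hf (by positivity)]
  rw [div_le_iff₀ hf] at h1
  calc (n : ℝ) ^ k * (k : ℝ) ^ k ≤ (n : ℝ) ^ k * (3 ^ k * k.factorial) := by gcongr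
    _ = _ := by ring

lemma numeric (r s : ℕ) (hs : 0 < s) (hr : 20000 * s ≤ r) :
    ((2 * r).choose s : ℝ) * (r.choose (4 * s) : ℝ) * ((4 * s / r : ℝ) ^ s) ^ 6
      ≤ (1 / 2) ^ s := by
  have hs' : (0 : ℝ) < s := by exact_mod_cast hs
  have hr0 : (0 : ℝ) < r := by
    have : 0 < r := by omega
    exact_mod_cast this
  have hr' : (20000 : ℝ) * s ≤ r := by exact_mod_cast hr
  have h1 := choose_bound (2 * r) s hs
  have h2 := choose_bound r (4 * s) (by omega)
  push_cast at h1 h2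
  calc ((2 * r).choose s : ℝ) * (r.choose (4 * s) : ℝ) * ((4 * s / r : ℝ) ^ s) ^ 6
      ≤ (3 * (2 * r) / s) ^ s * (3 * r / (4 * s)) ^ (4 * s) * ((4 * s / r : ℝ) ^ s) ^ 6 := by
        gcongr
    _ = (7776 * s / r : ℝ) ^ s := by
        rw [pow_mul, pow_right_comm (4 * s / r : ℝ) s 6, ← mul_pow, ← mul_pow]
        congr 1
        field_simp
        norm_num
    _ ≤ (1 / 2 : ℝ) ^ s := by
        refine pow_le_pow_left₀ (by positivity) ?_ s
        rw [div_le_div_iff₀ hr0 (by norm_num)]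
        linarith

/-- Existence of a family of permutations without small badly expanding sets. -/
lemma exists_good (R : Type) [Fintype R] :
    ∃ σ : Fin 6 → Equiv.Perm (R × Bool), ∀ (S : Finset (R × Bool)) (T : Finset R),
      0 < S.card → 20000 * S.card ≤ Fintype.card R → T.card = 4 * S.card →
        ∃ j, ∃ v ∈ S, (σ j v).1 ∉ T := by
  by_contra hcon
  push Not at hcon
  set r := Fintype.card R with hr
  set M := Nat.card (Equiv.Perm (R × Bool)) with hM
  have hMpos : 0 < M := Nat.card_pos
  let B : Finset (R × Bool) → Finset R → Finset (Fin 6 → Equiv.Perm (R × Bool)) :=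
    fun S T => Fintype.piFinset (fun _ => permsInto S (T ×ˢ (Finset.univ : Finset Bool)))
  have hcover : (Finset.univ : Finset (Fin 6 → Equiv.Perm (R × Bool))) ⊆
      (Finset.Icc 1 (r / 20000)).biUnion (fun s =>
        (Finset.powersetCard s Finset.univ).biUnion (fun S =>
          (Finset.powersetCard (4 * s) Finset.univ).biUnion (fun T => B S T))) := by
    intro σ _
    obtain ⟨S, T, h1, h2, h3, h4⟩ := hcon σ
    simp only [Finset.mem_biUnion, Finset.mem_Icc, Finset.mem_powersetCard, Finset.subset_univ,
      true_and]
    refine ⟨S.card, ⟨h1, by omega⟩, S, rfl, T, h3, ?_⟩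
    simp only [B, Fintype.mem_piFinset, permsInto, Finset.mem_filter, Finset.mem_univ, true_and,
      Finset.mem_product, and_true]
    exact h4
  have hB : ∀ s ∈ Finset.Icc 1 (r / 20000), ∀ S ∈ Finset.powersetCard s (Finset.univ : Finset (R × Bool)),
      ∀ T ∈ Finset.powersetCard (4 * s) (Finset.univ : Finset R),
      ((B S T).card : ℝ) ≤ ((4 * s / r : ℝ) ^ s) ^ 6 * (M : ℝ) ^ 6 := by
    intro s hs S hS T hT
    rw [Finset.mem_powersetCard] at hS hT
    rw [Finset.mem_Icc] at hs
    have hr0 : (0 : ℝ) < r := by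
      have : 0 < r := by omega
      exact_mod_cast this
    have h := permsInto_card S (T ×ˢ (Finset.univ : Finset Bool))
    rw [Finset.card_product, hS.2, hT.2, Fintype.card_prod] at h
    simp only [Finset.card_univ, Fintype.card_bool] at h
    have h' : ((permsInto S (T ×ˢ (Finset.univ : Finset Bool))).card : ℝ)
        ≤ (4 * s / r : ℝ) ^ s * M := by
      have h2 : ((r : ℝ) * 2) ^ s * ((permsInto S (T ×ˢ (Finset.univ : Finset Bool))).card : ℝ)
          ≤ (4 * s * 2) ^ s * M := by exact_mod_cast h
      have h3 : (4 * s / r : ℝ) ^ s * M = ((4 * s * 2) ^ s * M) / ((r : ℝ) * 2) ^ s := by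
        have h4 : (4 * s / r : ℝ) = (4 * s * 2) / (r * 2) := by field_simp
        rw [h4, div_pow]
        ring
      rw [h3, le_div_iff₀ (by positivity)]
      linarith
    have hc : (B S T).card = (permsInto S (T ×ˢ (Finset.univ : Finset Bool))).card ^ 6 := by
      simp [B, Fintype.card_piFinset]
    rw [hc, ← mul_pow]
    push_cast
    exact pow_le_pow_left₀ (by positivity) h' 6
  have hcard : (M : ℝ) ^ 6 ≤ ∑ s ∈ Finset.Icc 1 (r / 20000), (1 / 2 : ℝ) ^ s * (M : ℝ) ^ 6 := by
    have h0 : (M : ℝ) ^ 6 = ((Finset.univ : Finset (Fin 6 → Equiv.Perm (R × Bool))).card : ℝ) := by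
      rw [Finset.card_univ, Fintype.card_fun, Fintype.card_fin, ← Nat.card_eq_fintype_card]
      push_cast
      rfl
    rw [h0]
    refine le_trans (Nat.cast_le.2 (Finset.card_le_card hcover)) ?_
    rw [← h0]
    refine le_trans (Nat.cast_le.2 Finset.card_biUnion_le) ?_
    rw [Nat.cast_sum]
    apply Finset.sum_le_sum
    intro s hs
    refine le_trans (Nat.cast_le.2 Finset.card_biUnion_le) ?_
    rw [Nat.cast_sum]
    have h1 : ∀ S ∈ Finset.powersetCard s (Finset.univ : Finset (R × Bool)),
        ((((Finset.powersetCard (4 * s) Finset.univ).biUnion (fun T => B S T)).card : ℕ) : ℝ)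
          ≤ (r.choose (4 * s) : ℝ) * (((4 * s / r : ℝ) ^ s) ^ 6 * (M : ℝ) ^ 6) := by
      intro S hS
      refine le_trans (Nat.cast_le.2 Finset.card_biUnion_le) ?_
      rw [Nat.cast_sum]
      refine le_trans (Finset.sum_le_card_nsmul _ _ _ (hB s hs S hS)) ?_
      rw [Finset.card_powersetCard, Finset.card_univ, nsmul_eq_mul]
    refine le_trans (Finset.sum_le_card_nsmul _ _ _ h1) ?_
    rw [Finset.card_powersetCard, Finset.card_univ, nsmul_eq_mul, Fintype.card_prod,
      Fintype.card_bool, mul_comm (Fintype.card R) 2]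
    rw [Finset.mem_Icc] at hs
    have := numeric r s (by omega) (by omega)
    calc _ = ((2 * r).choose s : ℝ) * (r.choose (4 * s) : ℝ) * ((4 * s / r : ℝ) ^ s) ^ 6
          * (M : ℝ) ^ 6 := by ring
      _ ≤ _ := by gcongr
  have hgeo : ∀ n : ℕ, ∑ s ∈ Finset.Icc 1 n, (1 / 2 : ℝ) ^ s = 1 - (1 / 2) ^ n := by
    intro n
    induction n with
    | zero => simp
    | succ n ih =>
      rw [Finset.sum_Icc_succ_top (by omega), ih, pow_succ]
      ring
  rw [← Finset.sum_mul, hgeo] at hcard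
  have hM6 : (0 : ℝ) < (M : ℝ) ^ 6 := by
    have : (0 : ℝ) < M := by exact_mod_cast hMpos
    positivity
  have : (0 : ℝ) < (1 / 2 : ℝ) ^ (r / 20000) * (M : ℝ) ^ 6 := by positivity
  linarith

/-- Unique-neighbour expanders. -/
lemma expander (R : Type) [Fintype R] :
    ∃ σ : Fin 6 → Equiv.Perm (R × Bool), ∀ S : Finset (R × Bool),
      20000 * S.card ≤ Fintype.card R →
      2 * S.card ≤ (Finset.univ.filter (fun ρ : R =>
        (Finset.univ.filter (fun p : Fin 6 × Bool => (σ p.1).symm (ρ, p.2) ∈ S)).card = 1)).card := by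
  obtain ⟨σ, hσ⟩ := exists_good R
  refine ⟨σ, fun S hS => ?_⟩
  rcases Nat.eq_zero_or_pos S.card with h0 | hpos
  · omega
  by_contra hlt
  push Not at hlt
  set f : R → ℕ := fun ρ =>
    (Finset.univ.filter (fun p : Fin 6 × Bool => (σ p.1).symm (ρ, p.2) ∈ S)).card with hf
  set U := Finset.univ.filter (fun ρ : R => f ρ = 1) with hU
  set N := Finset.univ.filter (fun ρ : R => 0 < f ρ) with hN
  have hsum : ∑ ρ, f ρ = 6 * S.card := by
    have h1 : ∀ ρ, f ρ = ∑ j : Fin 6, ∑ b : Bool, if (σ j).symm (ρ, b) ∈ S then 1 else 0 := by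
      intro ρ
      rw [hf]
      simp only []
      rw [Finset.card_filter, Fintype.sum_prod_type]
    simp_rw [h1]
    rw [Finset.sum_comm]
    have h2 : ∀ j : Fin 6, (∑ ρ : R, ∑ b : Bool, if (σ j).symm (ρ, b) ∈ S then 1 else 0)
        = S.card := by
      intro j
      rw [← Fintype.sum_prod_type (fun q : R × Bool => if (σ j).symm q ∈ S then 1 else 0)]
      rw [Equiv.sum_comp (σ j).symm (fun q => if q ∈ S then 1 else 0)]
      simp
    simp_rw [h2]
    simp
  have hle : 2 * N.card ≤ (∑ ρ, f ρ) + U.card := by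
    rw [hN, hU, Finset.card_filter, Finset.card_filter, Finset.mul_sum, ← Finset.sum_add_distrib]
    apply Finset.sum_le_sum
    intro ρ _
    split_ifs <;> omega
  have hN4 : N.card ≤ 4 * S.card := by omega
  obtain ⟨T, hNT, hT⟩ := Finset.exists_superset_card_eq hN4 (by omega)
  obtain ⟨j, v, hv, hnot⟩ := hσ S T hpos hS hT
  apply hnot
  apply hNT
  rw [hN, Finset.mem_filter]
  refine ⟨Finset.mem_univ _, ?_⟩
  rw [hf]
  apply Finset.card_pos.2
  refine ⟨(j, (σ j v).2), ?_⟩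
  simp [hv]

lemma prod_notMem_s11 {G : Type} [Group G] (H : Subgroup G) {ι : Type} (g : ι → G) (L : List ι)
    (hL : L.Nodup) (p : ι) (hp : p ∈ L) (hgp : g p ∉ H) (hq : ∀ q ∈ L, q ≠ p → g q ∈ H) :
    (L.map g).prod ∉ H := by
  obtain ⟨s, t, rfl⟩ := List.append_of_mem hp
  have hs : (s.map g).prod ∈ H := by
    apply Subgroup.list_prod_mem
    intro y hy
    obtain ⟨q, hqs, rfl⟩ := List.mem_map.1 hy
    apply hq q (by simp [hqs])
    rintro rfl
    simp [List.nodup_append] at hL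
    grind
  have ht : (t.map g).prod ∈ H := by
    apply Subgroup.list_prod_mem
    intro y hy
    obtain ⟨q, hqs, rfl⟩ := List.mem_map.1 hy
    apply hq q (by simp [hqs])
    rintro rfl
    simp [List.nodup_append] at hL
    grind
  rw [List.map_append, List.prod_append, List.map_cons, List.prod_cons,
    H.mul_mem_cancel_left hs, H.mul_mem_cancel_right ht]
  exact hgp

lemma len_prod {G : Type} [Group G] (l : G → ℕ) (h1 : l 1 = 0)
    (hm : ∀ a b, l (a * b) ≤ l a + l b) {ι : Type} (g : ι → G) (B : ℕ) (hB : ∀ i, l (g i) ≤ B)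
    (L : List ι) : l (L.map g).prod ≤ L.length * B := by
  induction L with
  | nil => simp [h1]
  | cons a L ih =>
    rw [List.map_cons, List.prod_cons, List.length_cons]
    have := hm (g a) (L.map g).prod
    have := hB a
    rw [add_mul]
    omega

lemma check_step {G : Type} [Group G] (l : G → ℕ) (h1 : l 1 = 0)
    (hm : ∀ a b, l (a * b) ≤ l a + l b) {I : Type} [Fintype I] (r : ℕ)
    (hI : Fintype.card I = 2 * r) (x : I → G) :
    ∃ c : Fin r → G, (∀ B, (∀ i, l (x i) ≤ B) → ∀ ρ, l (c ρ) ≤ 12 * B) ∧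
      ∀ H : Subgroup G, 20000 * (Finset.univ.filter (fun i => x i ∉ H)).card ≤ r →
        2 * (Finset.univ.filter (fun i => x i ∉ H)).card
          ≤ (Finset.univ.filter (fun ρ => c ρ ∉ H)).card := by
  obtain ⟨σ, hσ⟩ := expander (Fin r)
  have e : (Fin r × Bool) ≃ I := Fintype.equivOfCardEq (by simp [hI, mul_comm])
  refine ⟨fun ρ => (((Finset.univ : Finset (Fin 6 × Bool)).toList).map
    (fun p => x (e ((σ p.1).symm (ρ, p.2))))).prod, ?_, ?_⟩
  · intro B hB ρ
    refine (len_prod l h1 hm _ B (fun i => hB _) _).trans ?_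
    simp
  · intro H hH
    have hcard : ((Finset.univ.filter (fun i => x i ∉ H)).map e.symm.toEmbedding).card
      = (Finset.univ.filter (fun i => x i ∉ H)).card := Finset.card_map _
    have h := hσ ((Finset.univ.filter (fun i => x i ∉ H)).map e.symm.toEmbedding)
      (by rw [hcard]; simpa using hH)
    rw [hcard] at h
    refine h.trans (Finset.card_le_card ?_)
    intro ρ hρ
    rw [Finset.mem_filter] at hρ ⊢
    refine ⟨Finset.mem_univ _, ?_⟩
    obtain ⟨p, hp⟩ := Finset.card_eq_one.1 hρ.2
    have hmem : ∀ q : Fin 6 × Bool, x (e ((σ q.1).symm (ρ, q.2))) ∉ H ↔ q = p := by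
      intro q
      have : q ∈ ({p} : Finset (Fin 6 × Bool)) ↔ q = p := Finset.mem_singleton
      rw [← this, ← hp]
      simp [Finset.mem_map_equiv]
    refine prod_notMem_s11 H _ _ (Finset.nodup_toList _) p (by simp) ((hmem p).2 rfl) ?_
    intro q _ hqp
    by_contra hq
    exact hqp ((hmem q).1 hq)

lemma card_filter_sum {G : Type} [Group G] (H : Subgroup G) {α β γ : Type} [Fintype α] [Fintype β]
    [Fintype γ] (x : α → G) (y : β → G) (z : γ → G) :
    (Finset.univ.filter (fun s => Sum.elim x (Sum.elim y z) s ∉ H)).card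
      = (Finset.univ.filter (fun a => x a ∉ H)).card
      + ((Finset.univ.filter (fun b => y b ∉ H)).card
      + (Finset.univ.filter (fun b => z b ∉ H)).card) := by
  simp only [Finset.card_filter, Fintype.sum_sum_type, Sum.elim_inl, Sum.elim_inr]
  congr!

lemma code {G : Type} [Group G] (l : G → ℕ) (h1 : l 1 = 0)
    (hm : ∀ a b, l (a * b) ≤ l a + l b) (m : ℕ) : ∀ (B : ℕ) (x : Fin (2 ^ m) → G),
    (∀ i, l (x i) ≤ B) → ∃ y : Fin (4 * 2 ^ m) → G, (∀ j, l (y j) ≤ 144 ^ m * B) ∧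
      ∀ H : Subgroup G, 40000 * (Finset.univ.filter (fun j => y j ∉ H)).card ≤ 2 ^ m →
        ∀ i, x i ∈ H := by
  induction m with
  | zero =>
    intro B x hx
    refine ⟨fun _ => x 0, fun _ => by simpa using hx 0, ?_⟩
    intro H hH i
    have hsub : Subsingleton (Fin (2 ^ 0)) := by rw [pow_zero]; infer_instance
    have hi : i = 0 := Subsingleton.elim _ _
    subst hi
    by_contra hcon
    simp [hcon] at hH
  | succ m ih =>
    intro B x hx
    obtain ⟨a, ha1, ha2⟩ := check_step l h1 hm (2 ^ m) (by simp [pow_succ, mul_comm]) x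
    obtain ⟨y, hy1, hy2⟩ := ih (12 * B) a (ha1 B hx)
    obtain ⟨c, hc1, hc2⟩ := check_step l h1 hm (2 ^ (m + 1))
      (by rw [Fintype.card_fin, pow_succ]; ring) y
    have e : Fin (4 * 2 ^ (m + 1)) ≃ Fin (2 ^ (m + 1)) ⊕ (Fin (4 * 2 ^ m) ⊕ Fin (2 ^ (m + 1))) :=
      Fintype.equivOfCardEq (by simp [pow_succ]; ring)
    refine ⟨fun j => Sum.elim x (Sum.elim y c) (e j), ?_, ?_⟩
    · have hpow : 1 ≤ 144 ^ m := Nat.one_le_pow _ _ (by norm_num)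
      have key : ∀ s, l (Sum.elim x (Sum.elim y c) s) ≤ 144 ^ (m + 1) * B := by
        rintro (i | j | ρ)
        · refine (hx i).trans ?_
          exact Nat.le_mul_of_pos_left _ (by positivity)
        · refine (hy1 j).trans ?_
          rw [pow_succ, mul_assoc]
          gcongr
          norm_num
        · refine (hc1 _ hy1 ρ).trans ?_
          apply le_of_eq
          rw [pow_succ]
          ring
      exact fun j => key _
    · intro H hH
      have hc : (Finset.univ.filter (fun j => Sum.elim x (Sum.elim y c) (e j) ∉ H)).card
          = (Finset.univ.filter (fun s => Sum.elim x (Sum.elim y c) s ∉ H)).card := by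
        rw [Finset.card_filter, Finset.card_filter]
        exact Equiv.sum_comp e (fun s => if Sum.elim x (Sum.elim y c) s ∉ H then 1 else 0)
      rw [hc, card_filter_sum] at hH
      have hp : 2 ^ (m + 1) = 2 * 2 ^ m := by rw [pow_succ]; ring
      have s1 := hc2 H (by omega)
      have s2 := hy2 H (by omega)
      have s3 := ha2 H (by omega)
      have s4 : (Finset.univ.filter (fun ρ => a ρ ∉ H)).card = 0 := by
        simp [s2]
      have s5 : (Finset.univ.filter (fun i => x i ∉ H)).card = 0 := by omega
      intro i
      by_contra hcon
      rw [Finset.card_eq_zero] at s5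
      have : i ∈ Finset.univ.filter (fun i => x i ∉ H) := by simp [hcon]
      rw [s5] at this
      simp at this

theorem stmt11 :
    ∃ δ C : ℝ, 0 < δ ∧ 0 < C ∧ ∃ e : ℕ, 0 < e ∧
      ∀ k : ℕ, 0 < k →
        ∃ A : Multiset (FreeGroup (Fin k)), A ≠ 0 ∧
          Multiset.card A ≤ 8 * k ∧
          (∀ w ∈ A, ((FreeGroup.toWord w).length : ℝ) ≤ C * (k : ℝ) ^ e) ∧
          Detects A δ := by
  refine ⟨1 / 160000, 256, by norm_num, by norm_num, 8, by norm_num, ?_⟩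
  intro k hk
  obtain ⟨m, hm1, hm2⟩ : ∃ m : ℕ, k ≤ 2 ^ m ∧ 2 ^ m ≤ 2 * k := by
    refine ⟨Nat.log 2 k + 1, (Nat.lt_pow_succ_log_self (by norm_num) k).le, ?_⟩
    have := Nat.pow_log_le_self 2 hk.ne'
    rw [pow_succ]
    omega
  let x : Fin (2 ^ m) → FreeGroup (Fin k) := fun i =>
    if h : (i : ℕ) < k then FreeGroup.of ⟨i, h⟩ else 1
  have hx : ∀ i, FreeGroup.norm (x i) ≤ 1 := by
    intro i
    simp only [x]
    split_ifs <;> simp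
  obtain ⟨y, hy1, hy2⟩ := code (G := FreeGroup (Fin k)) FreeGroup.norm FreeGroup.norm_one
    FreeGroup.norm_mul_le m 1 x hx
  refine ⟨(Finset.univ : Finset (Fin (4 * 2 ^ m))).val.map y, ?_, ?_, ?_, ?_⟩
  · intro h
    have := congrArg Multiset.card h
    simp at this
  · simp
    omega
  · intro w hw
    obtain ⟨j, _, rfl⟩ := Multiset.mem_map.1 hw
    have h1 : FreeGroup.norm (y j) ≤ 256 * k ^ 8 := by
      calc FreeGroup.norm (y j) ≤ 144 ^ m * 1 := hy1 j
        _ ≤ 256 ^ m := by rw [mul_one]; exact Nat.pow_le_pow_left (by norm_num) m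
        _ = (2 ^ m) ^ 8 := by rw [← pow_mul, mul_comm, pow_mul]; norm_num
        _ ≤ (2 * k) ^ 8 := Nat.pow_le_pow_left hm2 8
        _ = 256 * k ^ 8 := by ring
    have h2 : (FreeGroup.toWord (y j)).length ≤ 256 * k ^ 8 := by
      exact h1
    exact_mod_cast h2
  · intro H hH
    have hgt : 2 ^ m < 40000 * (Finset.univ.filter (fun j => y j ∉ H)).card := by
      by_contra hcon
      apply hH
      have hall := hy2 H (by omega)
      rw [eq_top_iff, ← FreeGroup.closure_range_of, Subgroup.closure_le]
      rintro _ ⟨i, rfl⟩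
      have := hall ⟨i, lt_of_lt_of_le i.2 hm1⟩
      simpa [x] using this
    have hsplit := Finset.card_filter_add_card_filter_not (s := (Finset.univ : Finset (Fin (4 * 2 ^ m))))
      (fun j => y j ∈ H)
    have hf : (((Finset.univ : Finset (Fin (4 * 2 ^ m))).val.map y).filter (fun a => a ∈ H)).card
        = (Finset.univ.filter (fun j => y j ∈ H)).card := by
      rw [Multiset.filter_map, Multiset.card_map]
      rfl
    rw [hf, Multiset.card_map]
    have hc : Multiset.card (Finset.univ : Finset (Fin (4 * 2 ^ m))).val = 4 * 2 ^ m := by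
      simp
    rw [hc]
    rw [Finset.card_univ, Fintype.card_fin] at hsplit
    have a1 : ((Finset.univ.filter (fun j => y j ∈ H)).card : ℝ)
        + ((Finset.univ.filter (fun j => y j ∉ H)).card : ℝ) = 4 * 2 ^ m := by
      exact_mod_cast hsplit
    have a2 : (2 : ℝ) ^ m < 40000 * ((Finset.univ.filter (fun j => y j ∉ H)).card : ℝ) := by
      exact_mod_cast hgt
    push_cast
    linarith
end

section
/- There exist real constants C ≥ 1 and δ > 0 such that for every positive integer k and every abelian group G generated by elements g₁, ..., g_k, there exists a finite nonempty multiset A of elements of G with |A| ≤ C·k such that A has detection probability at least δ in G, and moreover every element of A can be written as a product of at most 2^(C·k) elements from {g₁^{±1}, ..., g_k^{±1}}. -/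
open scoped Classical

theorem exists_functional {k : ℕ} {G : Type*} [CommGroup G] (g : Fin k → G)
    (hg : Subgroup.closure (Set.range g) = ⊤) (H : Subgroup G) (hH : H ≠ ⊤) :
    ∃ p : ℕ, p.Prime ∧ ∃ c : Fin k → ZMod p, c ≠ 0 ∧
      ∀ n : Fin k → ℕ, (∏ j, g j ^ n j) ∈ H → ∑ j, (n j : ZMod p) * c j = 0 := by
  have hfg : Group.FG G := ⟨⟨(Set.finite_range g).toFinset, by simpa using hg⟩⟩
  have : Module.Finite ℤ (Additive G) := Module.Finite.iff_addGroup_fg.2 inferInstance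
  have : IsCoatomic (Subgroup G) :=
    ((Subgroup.toAddSubgroup (G := G)).trans AddSubgroup.toIntSubmodule).isCoatomic_iff.2
      inferInstance
  obtain ⟨M, hM, hHM⟩ := (eq_top_or_exists_le_coatom H).resolve_left hH
  have : IsSimpleGroup (G ⧸ M) := by
    have : Nontrivial (G ⧸ M) := QuotientGroup.nontrivial_iff.2 hM.1
    refine ⟨fun K _ => ?_⟩
    have hle : M ≤ K.comap (QuotientGroup.mk' M) := by
      intro x hx
      have : QuotientGroup.mk' M x = 1 := (QuotientGroup.eq_one_iff x).2 hx
      simp only [Subgroup.mem_comap, this, one_mem]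
    rcases hM.le_iff.1 hle with h | h
    · right
      rw [eq_top_iff]
      intro y _
      obtain ⟨x, rfl⟩ := QuotientGroup.mk'_surjective M y
      have : x ∈ K.comap (QuotientGroup.mk' M) := h ▸ Subgroup.mem_top x
      exact this
    · left
      rw [eq_bot_iff]
      intro y hy
      obtain ⟨x, rfl⟩ := QuotientGroup.mk'_surjective M y
      have : x ∈ M := h ▸ hy
      exact (QuotientGroup.eq_one_iff x).2 this
  obtain ⟨p, hp, ⟨e⟩⟩ := exists_prime_addEquiv_ZMod (G := G ⧸ M)
  let φ : G →* Multiplicative (ZMod p) :=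
    (AddMonoidHom.toMultiplicativeRight e.toAddMonoidHom).comp (QuotientGroup.mk' M)
  have hφ : ∀ x, φ x = 1 ↔ x ∈ M := by
    intro x
    have : φ x = Multiplicative.ofAdd (e (Additive.ofMul (QuotientGroup.mk' M x))) := rfl
    rw [this, ofAdd_eq_one, EmbeddingLike.map_eq_zero_iff, ofMul_eq_zero]
    exact QuotientGroup.eq_one_iff x
  refine ⟨p, hp, fun j => (φ (g j)).toAdd, ?_, ?_⟩
  · intro h0
    apply hM.1
    rw [eq_top_iff, ← hg, Subgroup.closure_le]
    rintro _ ⟨j, rfl⟩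
    exact (hφ _).1 (congrFun h0 j)
  · intro n hn
    have := (hφ _).2 (hHM hn)
    rw [map_prod] at this
    have := congrArg Multiplicative.toAdd this
    simpa [toAdd_prod] using this

theorem pascal_code {k p : ℕ} (hp : p.Prime) (hk : 0 < k) (hkp : 5 * k ≤ p) (c : Fin k → ZMod p)
    (hc : c ≠ 0) :
    (Finset.univ.filter fun i : Fin (5 * k) =>
      ∑ j : Fin k, ((Nat.choose i j : ℕ) : ZMod p) * c j = 0).card < k := by
  have := Fact.mk hp
  have hfac : ∀ j : Fin k, ((Nat.factorial j : ℕ) : ZMod p) ≠ 0 := by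
    intro j h
    rw [ZMod.natCast_eq_zero_iff, hp.dvd_factorial] at h
    have := j.2
    omega
  let S : Polynomial.Sequence (ZMod p) := ⟨fun n => descPochhammer (ZMod p) n, fun n => by
    rw [Polynomial.degree_eq_natDegree (monic_descPochhammer _ _).ne_zero,
      descPochhammer_natDegree]⟩
  let P : Polynomial (ZMod p) :=
    ∑ j : Fin k, (c j * ((Nat.factorial j : ℕ) : ZMod p)⁻¹) • descPochhammer (ZMod p) j
  have hP : P ≠ 0 := by
    intro h0
    have hli := S.linearIndependent.comp (fun j : Fin k => (j : ℕ)) Fin.val_injective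
    have := Fintype.linearIndependent_iff.1 hli _ h0
    apply hc
    funext j
    have := this j
    simpa [hfac j] using this
  have hdeg : P.natDegree < k := by
    have : P.natDegree ≤ k - 1 := by
      refine Polynomial.natDegree_sum_le_of_forall_le _ _ fun j _ => ?_
      refine (Polynomial.natDegree_smul_le _ _).trans ?_
      rw [descPochhammer_natDegree]
      have := j.2
      omega
    omega
  have heval : ∀ i : ℕ, P.eval (i : ZMod p) = ∑ j : Fin k, ((Nat.choose i j : ℕ) : ZMod p) * c j := by
    intro i
    simp only [P, Polynomial.eval_finsetSum, Polynomial.eval_smul,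
      descPochhammer_eval_eq_descFactorial, Nat.descFactorial_eq_factorial_mul_choose]
    refine Finset.sum_congr rfl fun j _ => ?_
    have := hfac j
    push_cast
    rw [smul_eq_mul]
    field_simp
  refine lt_of_le_of_lt ?_ hdeg
  refine le_trans ?_ (Polynomial.card_roots' P)
  refine le_trans ?_ (Multiset.toFinset_card_le _)
  refine Finset.card_le_card_of_injOn (fun i => ((i : ℕ) : ZMod p)) ?_ ?_
  · intro i hi
    have hi := (Finset.mem_filter.1 hi).2
    simp only [Finset.mem_coe, Multiset.mem_toFinset]
    rw [Polynomial.mem_roots hP, Polynomial.IsRoot, heval]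
    exact hi
  · intro i _ j _ h
    have := congrArg ZMod.val h
    simp only at this
    rw [ZMod.val_cast_of_lt (by omega), ZMod.val_cast_of_lt (by omega)] at this
    exact Fin.ext this

theorem kernel_count {k p : ℕ} [Fact p.Prime] (c : Fin k → ZMod p)
    (hc : c ≠ 0) :
    p * (Finset.univ.filter fun a : Fin k → ZMod p => ∑ j, a j * c j = 0).card = p ^ k := by
  let f : (Fin k → ZMod p) →+ ZMod p :=
    { toFun := fun a => ∑ j, a j * c j
      map_zero' := by simp
      map_add' := by intro a b; simp [add_mul, Finset.sum_add_distrib] }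
  have hs : Function.Surjective f := by
    obtain ⟨j, hj⟩ := Function.ne_iff.1 hc
    intro y
    refine ⟨Pi.single j (y * (c j)⁻¹), ?_⟩
    have hj : c j ≠ 0 := hj
    simp [f, Pi.single_apply, hj]
  have h1 := AddSubgroup.card_mul_index f.ker
  rw [AddSubgroup.index_ker, AddMonoidHom.range_eq_top.2 hs] at h1
  have h2 : Nat.card f.ker = (Finset.univ.filter fun a : Fin k → ZMod p => ∑ j, a j * c j = 0).card := by
    rw [← Fintype.card_subtype, Nat.card_eq_fintype_card]
    refine Fintype.card_congr (Equiv.refl _)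
  rw [h2] at h1
  simpa [mul_comm] using h1

theorem arith_bound {p : ℕ} (hp : 2 ≤ p) : (2 * p - 1) ^ 5 ≤ p ^ 8 := by
  rcases Nat.lt_or_ge p 4 with h | h
  · interval_cases p <;> norm_num
  · calc (2 * p - 1) ^ 5 ≤ (2 * p) ^ 5 := Nat.pow_le_pow_left (by omega) _
      _ = 32 * p ^ 5 := by ring
      _ ≤ p ^ 3 * p ^ 5 := Nat.mul_le_mul_right _ (by nlinarith [Nat.pow_le_pow_left h 3])
      _ = p ^ 8 := by ring

theorem gv_code {k p : ℕ} (hp : p.Prime) (hk : 0 < k) :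
    ∃ B : Fin (5 * k) → Fin k → ZMod p, ∀ c : Fin k → ZMod p, c ≠ 0 →
      (Finset.univ.filter fun i => ∑ j, B i j * c j = 0).card ≤ 4 * k := by
  have := Fact.mk hp
  by_contra! hcon
  choose c hc0 hcard using hcon
  -- weight
  let w : (Fin k → ZMod p) → (Fin k → ZMod p) → ℕ := fun c a => if ∑ j, a j * c j = 0 then p else 1
  have hsum : ∀ c, c ≠ 0 → p * ∑ a, w c a = (2 * p - 1) * p ^ k := by
    intro c hc
    have h := kernel_count c hc
    have htot : (Finset.univ.filter fun a : Fin k → ZMod p => ∑ j, a j * c j = 0).card +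
        (Finset.univ.filter fun a : Fin k → ZMod p => ¬ ∑ j, a j * c j = 0).card = p ^ k := by
      rw [Finset.card_filter_add_card_filter_not]
      simp [ZMod.card]
    simp only [w, Finset.sum_ite, Finset.sum_const, smul_eq_mul, mul_one]
    have hp1 := hp.one_lt
    obtain ⟨q, rfl⟩ : ∃ q, p = q + 1 := ⟨p - 1, by omega⟩
    have : 2 * (q + 1) - 1 = 2 * q + 1 := by omega
    rw [this]
    nlinarith
  have hB : ∀ B, p ^ (4 * k + 1) ≤ ∏ i, w (c B) (B i) := by
    intro B
    simp only [w, Finset.prod_ite, Finset.prod_const, one_pow, mul_one]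
    exact Nat.pow_le_pow_right hp.pos (hcard B)
  have hprod : ∀ c, ∑ B : Fin (5 * k) → Fin k → ZMod p, ∏ i, w c (B i) = (∑ a, w c a) ^ (5 * k) := by
    intro c
    simpa using (Finset.sum_pow' (Finset.univ) (w c) (5 * k)).symm
  have hbig : p ^ (k * (5 * k)) * p ^ (4 * k + 1) ≤
      ∑ c ∈ Finset.univ.filter (fun c : Fin k → ZMod p => c ≠ 0), (∑ a, w c a) ^ (5 * k) := by
    calc p ^ (k * (5 * k)) * p ^ (4 * k + 1)
        = ∑ B : Fin (5 * k) → Fin k → ZMod p, p ^ (4 * k + 1) := by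
          simp [ZMod.card, pow_mul]
      _ ≤ ∑ B : Fin (5 * k) → Fin k → ZMod p, ∏ i, w (c B) (B i) :=
          Finset.sum_le_sum fun B _ => hB B
      _ ≤ ∑ B : Fin (5 * k) → Fin k → ZMod p,
            ∑ c ∈ Finset.univ.filter (fun c : Fin k → ZMod p => c ≠ 0), ∏ i, w c (B i) := by
          refine Finset.sum_le_sum fun B _ => ?_
          exact Finset.single_le_sum (f := fun c => ∏ i, w c (B i)) (fun _ _ => Nat.zero_le _)
            (Finset.mem_filter.2 ⟨Finset.mem_univ _, hc0 B⟩)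
      _ = _ := by
          rw [Finset.sum_comm]
          exact Finset.sum_congr rfl fun c _ => hprod c
  have hone : ∀ c ∈ Finset.univ.filter (fun c : Fin k → ZMod p => c ≠ 0),
      p ^ (5 * k) * (∑ a, w c a) ^ (5 * k) ≤ p ^ (8 * k) * p ^ (k * (5 * k)) := by
    intro c hc
    rw [← mul_pow, hsum c (Finset.mem_filter.1 hc).2, mul_pow, ← pow_mul]
    refine Nat.mul_le_mul_right _ ?_
    rw [pow_mul, pow_mul]
    exact Nat.pow_le_pow_left (arith_bound hp.two_le) k
  have h3 : p ^ (5 * k) * (p ^ (k * (5 * k)) * p ^ (4 * k + 1)) ≤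
      p ^ k * (p ^ (8 * k) * p ^ (k * (5 * k))) := by
    refine (Nat.mul_le_mul_left _ hbig).trans ?_
    rw [Finset.mul_sum]
    refine (Finset.sum_le_card_nsmul _ _ _ hone).trans ?_
    rw [smul_eq_mul]
    refine Nat.mul_le_mul_right _ ?_
    refine (Finset.card_le_univ _).trans ?_
    simp [ZMod.card]
  rw [← pow_add, ← pow_add, ← pow_add, ← pow_add] at h3
  have := (Nat.pow_le_pow_iff_right hp.one_lt).1 h3
  omega

theorem crt_code (k : ℕ) (hk : 0 < k) :
    ∃ B : Fin (5 * k) → Fin k → ℕ, (∀ i j, B i j ≤ 4 ^ (5 * k)) ∧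
      ∀ p : ℕ, p.Prime → p ≤ 5 * k → ∀ c : Fin k → ZMod p, c ≠ 0 →
      (Finset.univ.filter fun i => ∑ j, (B i j : ZMod p) * c j = 0).card ≤ 4 * k := by
  have hex : ∀ p : ℕ, ∃ B : Fin (5 * k) → Fin k → ZMod p, p.Prime → ∀ c : Fin k → ZMod p, c ≠ 0 →
      (Finset.univ.filter fun i => ∑ j, B i j * c j = 0).card ≤ 4 * k := by
    intro p
    by_cases hp : p.Prime
    · obtain ⟨B, hB⟩ := gv_code hp hk
      exact ⟨B, fun _ => hB⟩
    · exact ⟨0, fun h => absurd h hp⟩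
  choose D hD using hex
  let t := (Finset.range (5 * k + 1)).filter Nat.Prime
  have hs : ∀ p ∈ t, id p ≠ 0 := fun p hp => (Finset.mem_filter.1 hp).2.ne_zero
  have pp : Set.Pairwise (t : Set ℕ) (Function.onFun Nat.Coprime id) := by
    intro p hp q hq hne
    exact (Nat.coprime_primes (Finset.mem_filter.1 hp).2 (Finset.mem_filter.1 hq).2).2 hne
  refine ⟨fun i j => Nat.chineseRemainderOfFinset (fun p => (D p i j).val) id t hs pp, ?_, ?_⟩
  · intro i j
    refine (Nat.chineseRemainderOfFinset_lt_prod _ _ hs pp).le.trans ?_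
    exact primorial_le_four_pow (5 * k)
  · intro p hp hpk c hc
    have := Fact.mk hp
    have h := hD p hp c hc
    have : ∀ i j, ((Nat.chineseRemainderOfFinset (fun p => (D p i j).val) id t hs pp : ℕ) : ZMod p)
        = D p i j := by
      intro i j
      have h := (Nat.chineseRemainderOfFinset (fun p => (D p i j).val) id t hs pp).2 p
        (Finset.mem_filter.2 ⟨Finset.mem_range.2 (by omega), hp⟩)
      have h := (ZMod.natCast_eq_natCast_iff _ _ p).2 h
      rw [h]
      simp
    simpa only [this] using h

theorem word_exists {k : ℕ} {G : Type*} [CommGroup G] (g : Fin k → G) (n : Fin k → ℕ)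
    (hn : ∀ j, n j ≤ 4 ^ (5 * k)) :
    ∃ l : List G, (∀ x ∈ l, ∃ i : Fin k, x = g i ∨ x = (g i)⁻¹) ∧
      (l.length : ℝ) ≤ (2 : ℝ) ^ ((11 : ℝ) * (k : ℝ)) ∧ l.prod = ∏ j, g j ^ n j := by
  refine ⟨(List.finRange k).flatMap fun j => List.replicate (n j) (g j), ?_, ?_, ?_⟩
  · intro x hx
    obtain ⟨j, _, hj⟩ := List.mem_flatMap.1 hx
    exact ⟨j, Or.inl (List.eq_of_mem_replicate hj)⟩
  · have h1 : ((List.finRange k).flatMap fun j => List.replicate (n j) (g j)).length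
        = ∑ j, n j := by
      rw [List.length_flatMap, Fin.sum_univ_def]
      simp
    have h2 : ∑ j, n j ≤ 2 ^ (11 * k) := by
      calc ∑ j, n j ≤ ∑ _j : Fin k, 4 ^ (5 * k) := Finset.sum_le_sum fun j _ => hn j
        _ = k * 4 ^ (5 * k) := by simp
        _ ≤ 2 ^ k * 4 ^ (5 * k) := Nat.mul_le_mul_right _ Nat.lt_two_pow_self.le
        _ = 2 ^ (11 * k) := by
          rw [show (4 : ℕ) = 2 ^ 2 by norm_num, ← pow_mul, ← pow_add]
          congr 1
          ring
    rw [h1]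
    have h3 : ((11 : ℝ) * (k : ℝ)) = ((11 * k : ℕ) : ℝ) := by push_cast; ring
    rw [h3, Real.rpow_natCast]
    exact_mod_cast h2
  · rw [List.flatMap, List.prod_flatten, Fin.prod_univ_def]
    simp [Function.comp_def]

theorem card_filter_map_le {ι G : Type*} [CommGroup G] [Fintype ι] {k p : ℕ} (g : Fin k → G)
    (H : Subgroup G) (c : Fin k → ZMod p)
    (h : ∀ n : Fin k → ℕ, (∏ j, g j ^ n j) ∈ H → ∑ j, (n j : ZMod p) * c j = 0)
    (B : ι → Fin k → ℕ) :
    (((Finset.univ : Finset ι).val.map fun i => ∏ j, g j ^ B i j).filter (fun a => a ∈ H)).card ≤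
      (Finset.univ.filter fun i => ∑ j, (B i j : ZMod p) * c j = 0).card := by
  rw [Multiset.filter_map, Multiset.card_map]
  change (Finset.univ.filter fun i => (∏ j, g j ^ B i j) ∈ H).card ≤ _
  refine Finset.card_le_card fun i hi => ?_
  simp only [Finset.mem_filter, Finset.mem_univ, true_and] at hi ⊢
  exact h _ hi

theorem stmt12 :
    ∃ C δ : ℝ, 1 ≤ C ∧ 0 < δ ∧
      ∀ k : ℕ, 0 < k → ∀ (G : Type*) [CommGroup G] (g : Fin k → G),
        Subgroup.closure (Set.range g) = ⊤ →
        ∃ A : Multiset G, A ≠ 0 ∧ (Multiset.card A : ℝ) ≤ C * k ∧ Detects A δ ∧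
          ∀ a ∈ A, ∃ l : List G,
            (∀ x ∈ l, ∃ i : Fin k, x = g i ∨ x = (g i)⁻¹) ∧
            (l.length : ℝ) ≤ (2 : ℝ) ^ (C * (k : ℝ)) ∧ l.prod = a := by
  refine ⟨11, 1 / 10, by norm_num, by norm_num, ?_⟩
  intro k hk G _ g hg
  obtain ⟨B, hBle, hB⟩ := crt_code k hk
  let A₁ : Multiset G := (Finset.univ : Finset (Fin (5 * k))).val.map fun i => ∏ j, g j ^ B i j
  let A₂ : Multiset G := (Finset.univ : Finset (Fin (5 * k))).val.map
    fun i : Fin (5 * k) => ∏ j : Fin k, g j ^ (Nat.choose (i : ℕ) (j : ℕ))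
  have hc1 : Multiset.card A₁ = 5 * k := by simp [A₁]
  have hc2 : Multiset.card A₂ = 5 * k := by simp [A₂]
  have hcard : Multiset.card (A₁ + A₂) = 10 * k := by
    rw [Multiset.card_add, hc1, hc2]; ring
  have hk' : (0 : ℝ) < k := by exact_mod_cast hk
  refine ⟨A₁ + A₂, ?_, ?_, ?_, ?_⟩
  · intro h
    rw [h, Multiset.card_zero] at hcard
    omega
  · rw [hcard]; push_cast; linarith
  · intro H hH
    obtain ⟨p, hp, c, hc, h⟩ := exists_functional g hg H hH
    have h1 := card_filter_map_le g H c h B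
    have h2 := card_filter_map_le g H c h
      (fun (i : Fin (5 * k)) (j : Fin k) => Nat.choose (i : ℕ) (j : ℕ))
    have h1' : (A₁.filter (fun a => a ∈ H)).card ≤ 5 * k :=
      hc1 ▸ Multiset.card_le_card (Multiset.filter_le _ _)
    have h2' : (A₂.filter (fun a => a ∈ H)).card ≤ 5 * k :=
      hc2 ▸ Multiset.card_le_card (Multiset.filter_le _ _)
    have key : ((A₁ + A₂).filter (fun a => a ∈ H)).card ≤ 9 * k := by
      rw [Multiset.filter_add, Multiset.card_add]
      rcases le_total p (5 * k) with hpk | hpk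
      · have h3 := h1.trans (hB p hp hpk c hc)
        change (A₁.filter (fun a => a ∈ H)).card ≤ _ at h3
        omega
      · have h3 := h2.trans (pascal_code hp hk hpk c hc).le
        change (A₂.filter (fun a => a ∈ H)).card ≤ _ at h3
        omega
    rw [hcard]
    have key' : (((A₁ + A₂).filter (fun a => a ∈ H)).card : ℝ) ≤ 9 * k := by exact_mod_cast key
    push_cast
    linarith
  · intro a ha
    rcases Multiset.mem_add.1 ha with ha | ha
    · obtain ⟨i, _, rfl⟩ := Multiset.mem_map.1 ha
      exact word_exists g _ (hBle i)
    · obtain ⟨i, _, rfl⟩ := Multiset.mem_map.1 ha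
      refine word_exists g _ fun j => ?_
      calc Nat.choose (i : ℕ) (j : ℕ) ≤ 2 ^ (i : ℕ) := Nat.choose_le_two_pow _ _
        _ ≤ 2 ^ (5 * k) := Nat.pow_le_pow_right (by norm_num) i.2.le
        _ ≤ 4 ^ (5 * k) := Nat.pow_le_pow_left (by norm_num) _
end
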